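/- arXiv:2309.06488 — 4 statements merged into one kernel-verified Lean document; each statement's English description precedes it below -/
import Mathlib

section
/- Let Λ be a finite set, let p : Λ → ℝ be nonnegative with ∑_λ p(λ) = 1, let q : Fin 4 × Λ → ℝ be nonnegative with ∑_{e} q(e,λ) = 1 for every λ, and let A : Fin 2 × Fin 4 × Λ → ℝ and B : Fin 2 × Fin 4 × Λ → ℝ satisfy |A(x,e,λ)| ≤ 1 and |B(y,e,λ)| ≤ 1 for all arguments. Define the correlator ⟨A_x B_y N_e⟩ := ∑_λ p(λ) q(e,λ) A(x,e,λ) B(y,e,λ), and define the functional I := ∑_{e=0}^{3} ( c₀(e)·⟨A_0 B_0 N_e⟩ − c₀(e)·⟨A_0 B_1 N_e⟩ + c₁(e)·⟨A_1 B_0 N_e⟩ + c₁(e)·⟨A_1 B_1 N_e⟩ ), where for e = 2i+j (i,j ∈ {0,1}) the signs are c₀(e) = (−1)^{i+j} and c₁(e) = (−1)^{i}. Then |I| ≤ 2. -/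
theorem abs_chsh_le_two {a a' b b' : ℝ} (ha : |a| ≤ 1) (ha' : |a'| ≤ 1)
    (hb : |b| ≤ 1) (hb' : |b'| ≤ 1) : |a * (b - b') + a' * (b + b')| ≤ 2 := by
  have hbb : |b - b'| + |b + b'| ≤ 2 := by
    rw [abs_le] at hb hb'
    rcases abs_cases (b - b') with h | h <;> rcases abs_cases (b + b') with h' | h' <;> linarith
  calc |a * (b - b') + a' * (b + b')|
      ≤ |a * (b - b')| + |a' * (b + b')| := abs_add_le _ _
    _ = |a| * |b - b'| + |a'| * |b + b'| := by rw [abs_mul, abs_mul]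
    _ ≤ 1 * |b - b'| + 1 * |b + b'| := by gcongr
    _ ≤ 2 := by simpa using hbb

/-- Fact 1 of the paper: the weak-bilocality functional `I` is bounded by 2
for classically independent (no-influence) hidden-variable correlations. -/
theorem classical_independence_bound {Λ : Type*} [Fintype Λ]
    (p : Λ → ℝ) (q : Fin 4 → Λ → ℝ)
    (A B : Fin 2 → Fin 4 → Λ → ℝ)
    (hp : ∀ l, 0 ≤ p l) (hpsum : ∑ l, p l = 1)
    (hq : ∀ e l, 0 ≤ q e l) (hqsum : ∀ l, ∑ e, q e l = 1)
    (hA : ∀ x e l, |A x e l| ≤ 1) (hB : ∀ y e l, |B y e l| ≤ 1)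
    (corr : Fin 2 → Fin 2 → Fin 4 → ℝ)
    (hcorr : ∀ x y e, corr x y e = ∑ l, p l * q e l * A x e l * B y e l)
    (c₀ c₁ : Fin 4 → ℝ)
    (hc₀ : c₀ = ![1, -1, -1, 1]) (hc₁ : c₁ = ![1, 1, -1, -1]) :
    |∑ e, (c₀ e * corr 0 0 e - c₀ e * corr 0 1 e
        + c₁ e * corr 1 0 e + c₁ e * corr 1 1 e)| ≤ 2 := by
  have hc₀_abs : ∀ e, |c₀ e| = 1 := by
    intro e
    fin_cases e <;> simp [hc₀]
  have hc₁_abs : ∀ e, |c₁ e| = 1 := by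
    intro e
    fin_cases e <;> simp [hc₁]
  have hchsh (e : Fin 4) (l : Λ) : |c₀ e * A 0 e l * (B 0 e l - B 1 e l)
      + c₁ e * A 1 e l * (B 0 e l + B 1 e l)| ≤ 2 :=
    abs_chsh_le_two (by rw [abs_mul, hc₀_abs, one_mul]; exact hA 0 e l)
      (by rw [abs_mul, hc₁_abs, one_mul]; exact hA 1 e l) (hB 0 e l) (hB 1 e l)
  calc |∑ e, (c₀ e * corr 0 0 e - c₀ e * corr 0 1 e
        + c₁ e * corr 1 0 e + c₁ e * corr 1 1 e)|
      = |∑ e, ∑ l, p l * q e l * (c₀ e * A 0 e l * (B 0 e l - B 1 e l)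
          + c₁ e * A 1 e l * (B 0 e l + B 1 e l))| := by
        congr 1
        refine Finset.sum_congr rfl fun e _ => ?_
        simp only [hcorr, Finset.mul_sum, ← Finset.sum_sub_distrib, ← Finset.sum_add_distrib]
        exact Finset.sum_congr rfl fun l _ => by ring
    _ ≤ ∑ e, ∑ l, |p l * q e l * (c₀ e * A 0 e l * (B 0 e l - B 1 e l)
          + c₁ e * A 1 e l * (B 0 e l + B 1 e l))| :=
        (Finset.abs_sum_le_sum_abs _ _).trans
          (Finset.sum_le_sum fun e _ => Finset.abs_sum_le_sum_abs _ _)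
    _ ≤ ∑ e, ∑ l, p l * q e l * 2 := by
        refine Finset.sum_le_sum fun e _ => Finset.sum_le_sum fun l _ => ?_
        have hpq : 0 ≤ p l * q e l := mul_nonneg (hp l) (hq e l)
        rw [abs_mul, abs_of_nonneg hpq]
        exact mul_le_mul_of_nonneg_left (hchsh e l) hpq
    _ = 2 := by
        rw [Finset.sum_comm]
        simp only [← Finset.sum_mul, ← Finset.mul_sum, hqsum, mul_one, hpsum, one_mul]
end

section
/- Let m, n be positive integers, let A₀, A₁ be Hermitian m × m complex matrices with A_x² ≤ 𝟙_m (i.e., 𝟙_m − A_x² is positive semidefinite) for x = 0,1, let B₀, B₁ be Hermitian n × n complex matrices with B_y² ≤ 𝟙_n for y = 0,1, and let s, t ∈ {−1, 1}. Then the Hermitian matrix 2√2 · 𝟙_{mn} − ( s · A₀ ⊗ (B₀ − B₁) + t · A₁ ⊗ (B₀ + B₁) ) is positive semidefinite, where ⊗ is the Kronecker product. -/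
open Matrix Kronecker
open scoped ComplexOrder

theorem Matrix.sub_kronecker {l m n p R : Type*} [NonUnitalNonAssocRing R]
    (A₁ A₂ : Matrix l m R) (B : Matrix n p R) : (A₁ - A₂) ⊗ₖ B = A₁ ⊗ₖ B - A₂ ⊗ₖ B := by
  ext
  simp [sub_mul]

theorem Matrix.kronecker_sub {l m n p R : Type*} [NonUnitalNonAssocRing R]
    (A : Matrix l m R) (B₁ B₂ : Matrix n p R) : A ⊗ₖ (B₁ - B₂) = A ⊗ₖ B₁ - A ⊗ₖ B₂ := by
  ext
  simp [mul_sub]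

/-- Tsirelson's inequality for Hermitian matrices squaring to at most the identity, where each
`aᵢ` commutes with each `bⱼ`, by a sum-of-squares decomposition. -/
theorem Matrix.posSemidef_two_sqrt_two_sub_chsh {ι : Type*} [Fintype ι] [DecidableEq ι]
    {a₀ a₁ b₀ b₁ : Matrix ι ι ℂ}
    (ha₀ : a₀.IsHermitian) (ha₁ : a₁.IsHermitian) (hb₀ : b₀.IsHermitian) (hb₁ : b₁.IsHermitian)
    (ha₀sq : (1 - a₀ * a₀).PosSemidef) (ha₁sq : (1 - a₁ * a₁).PosSemidef)
    (hb₀sq : (1 - b₀ * b₀).PosSemidef) (hb₁sq : (1 - b₁ * b₁).PosSemidef)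
    (h₀₀ : Commute a₀ b₀) (h₀₁ : Commute a₀ b₁) (h₁₀ : Commute a₁ b₀) (h₁₁ : Commute a₁ b₁) :
    ((2 * Real.sqrt 2) • (1 : Matrix ι ι ℂ)
      - (a₀ * (b₀ - b₁) + a₁ * (b₀ + b₁))).PosSemidef := by
  obtain ⟨c, hc, hc2, hcs⟩ : ∃ c : ℝ, 0 ≤ c ∧ c * c = 1 / 2 ∧ Real.sqrt 2 = 2 * c := by
    refine ⟨Real.sqrt 2 / 2, by positivity, ?_, by ring⟩
    have := Real.mul_self_sqrt (show (0 : ℝ) ≤ 2 by norm_num)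
    linarith
  have hsq {P : Matrix ι ι ℂ} (hP : P.IsHermitian) : (P * P).PosSemidef := by
    simpa only [hP.eq] using posSemidef_conjTranspose_mul_self P
  have hP : (a₀ - c • (b₀ - b₁)).IsHermitian :=
    ha₀.sub ((hb₀.sub hb₁).smul (IsSelfAdjoint.all c))
  have hQ : (a₁ - c • (b₀ + b₁)).IsHermitian :=
    ha₁.sub ((hb₀.add hb₁).smul (IsSelfAdjoint.all c))
  have key := ((((ha₀sq.add ha₁sq).add (hb₀sq.add hb₁sq)).add
    ((hsq hP).add (hsq hQ))).smul hc)
  convert key using 1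
  simp only [hcs, mul_add, add_mul, mul_sub, sub_mul, smul_mul_assoc, mul_smul_comm, smul_add,
    smul_sub, smul_smul, h₀₀.eq, h₀₁.eq, h₁₀.eq, h₁₁.eq, hc2]
  match_scalars <;> linarith

/-- Tsirelson-type operator inequality: each sign-variant of the CHSH Bell
operator built from dichotomic observables is bounded above by `2√2 · 𝟙`. -/
theorem chsh_operator_le_tsirelson {m n : ℕ} (hm : 0 < m) (hn : 0 < n)
    (A₀ A₁ : Matrix (Fin m) (Fin m) ℂ) (B₀ B₁ : Matrix (Fin n) (Fin n) ℂ)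
    (hA₀ : A₀.IsHermitian) (hA₁ : A₁.IsHermitian)
    (hB₀ : B₀.IsHermitian) (hB₁ : B₁.IsHermitian)
    (hA₀sq : (1 - A₀ * A₀).PosSemidef) (hA₁sq : (1 - A₁ * A₁).PosSemidef)
    (hB₀sq : (1 - B₀ * B₀).PosSemidef) (hB₁sq : (1 - B₁ * B₁).PosSemidef)
    (s t : ℝ) (hs : s = -1 ∨ s = 1) (ht : t = -1 ∨ t = 1) :
    ((2 * Real.sqrt 2) • (1 : Matrix (Fin m × Fin n) (Fin m × Fin n) ℂ)
      - (s • (A₀ ⊗ₖ (B₀ - B₁)) + t • (A₁ ⊗ₖ (B₀ + B₁)))).PosSemidef := by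
  have hL {A : Matrix (Fin m) (Fin m) ℂ} (hA : A.IsHermitian) {r : ℝ} :
      (r • (A ⊗ₖ (1 : Matrix (Fin n) (Fin n) ℂ))).IsHermitian :=
    IsHermitian.smul (by simp [IsHermitian, conjTranspose_kronecker, hA.eq]) (IsSelfAdjoint.all r)
  have hR {B : Matrix (Fin n) (Fin n) ℂ} (hB : B.IsHermitian) :
      ((1 : Matrix (Fin m) (Fin m) ℂ) ⊗ₖ B).IsHermitian := by
    simp [IsHermitian, conjTranspose_kronecker, hB.eq]
  have hLsq {A : Matrix (Fin m) (Fin m) ℂ} (hA : (1 - A * A).PosSemidef) {r : ℝ}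
      (hr : r = -1 ∨ r = 1) :
      (1 - (r • (A ⊗ₖ (1 : Matrix (Fin n) (Fin n) ℂ))) * (r • (A ⊗ₖ 1))).PosSemidef := by
    have hrr : r * r = 1 := by rcases hr with rfl | rfl <;> norm_num
    rw [smul_mul_assoc, mul_smul_comm, smul_smul, hrr, one_smul, ← mul_kronecker_mul, mul_one,
      ← one_kronecker_one, ← sub_kronecker]
    exact hA.kronecker PosSemidef.one
  have hRsq {B : Matrix (Fin n) (Fin n) ℂ} (hB : (1 - B * B).PosSemidef) :
      (1 - ((1 : Matrix (Fin m) (Fin m) ℂ) ⊗ₖ B) * (1 ⊗ₖ B)).PosSemidef := by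
    rw [← mul_kronecker_mul, mul_one, ← one_kronecker_one, ← kronecker_sub]
    exact PosSemidef.one.kronecker hB
  have hcomm (A : Matrix (Fin m) (Fin m) ℂ) (B : Matrix (Fin n) (Fin n) ℂ) (r : ℝ) :
      Commute (r • (A ⊗ₖ (1 : Matrix (Fin n) (Fin n) ℂ))) (1 ⊗ₖ B) := by
    refine Commute.smul_left ?_ r
    simp [Commute, SemiconjBy, ← mul_kronecker_mul]
  convert posSemidef_two_sqrt_two_sub_chsh (hL hA₀ (r := s)) (hL hA₁ (r := t)) (hR hB₀) (hR hB₁)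
    (hLsq hA₀sq hs) (hLsq hA₁sq ht) (hRsq hB₀sq) (hRsq hB₁sq)
    (hcomm _ _ _) (hcomm _ _ _) (hcomm _ _ _) (hcomm _ _ _) using 3
  · rw [← kronecker_sub, smul_mul_assoc, ← mul_kronecker_mul, mul_one, one_mul]
  · rw [← kronecker_add, smul_mul_assoc, ← mul_kronecker_mul, mul_one, one_mul]
end

section
/- Let σ_z and σ_x denote the Pauli matrices, let A₀ = σ_z, A₁ = σ_x, B₀ = (σ_z + σ_x)/√2, B₁ = (σ_x − σ_z)/√2, and for i,j ∈ {0,1} let N_{2i+j} = |φ_{ij}⟩⟨φ_{ij}| be the Bell-basis projections on ℂ² ⊗ ℂ², where |φ_{ij}⟩ = (|i,j⟩ + (−1)^i |1−i, 1−j⟩)/√2. Let |ψ⟩ ∈ ℂ² ⊗ ℂ² ⊗ (ℂ² ⊗ ℂ²) be the unit vector |ψ⟩ = (1/2) ∑_{k,l∈{0,1}} |k⟩ ⊗ |l⟩ ⊗ |k,l⟩ (tensor factors ordered as Alice, Bob, Eve). Define ℰ₀ = N₀ − N₁ − N₂ + N₃ and ℰ₁ = N₀ + N₁ − N₂ − N₃.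 Then ⟨ψ| ( A₀ ⊗ (B₀ − B₁) ⊗ ℰ₀ + A₁ ⊗ (B₀ + B₁) ⊗ ℰ₁ ) |ψ⟩ = 2√2. -/
open Matrix Kronecker

/-- Pauli `σ_z`. -/
noncomputable def pauliZ : Matrix (Fin 2) (Fin 2) ℂ := !![1, 0; 0, -1]

/-- Pauli `σ_x`. -/
noncomputable def pauliX : Matrix (Fin 2) (Fin 2) ℂ := !![0, 1; 1, 0]

/-- Bell state `|φ_{ij}⟩ = (|i,j⟩ + (−1)^i |1−i,1−j⟩)/√2` on `ℂ² ⊗ ℂ²`. -/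
noncomputable def bellVec (i j : Fin 2) : Fin 2 × Fin 2 → ℂ := fun p =>
  ((if p = (i, j) then 1 else 0) +
      (-1) ^ (i : ℕ) * (if p = (1 - i, 1 - j) then 1 else 0)) / Real.sqrt 2

/-- Bell-basis projection `N_{2i+j} = |φ_{ij}⟩⟨φ_{ij}|`. -/
noncomputable def bellProj (i j : Fin 2) :
    Matrix (Fin 2 × Fin 2) (Fin 2 × Fin 2) ℂ :=
  vecMulVec (bellVec i j) (star (bellVec i j))

/-- The state `|ψ⟩ = (1/2) ∑_{k,l} |k⟩ ⊗ |l⟩ ⊗ |k,l⟩` (factors ordered as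
Alice, Bob, Eve), i.e. `|φ⁺_{AĀ}⟩ ⊗ |φ⁺_{BB̄}⟩` with factors reordered. -/
noncomputable def ψABE : Fin 2 × Fin 2 × (Fin 2 × Fin 2) → ℂ := fun t =>
  if t.2.2 = (t.1, t.2.1) then (1 / 2 : ℂ) else 0

lemma ofReal_sqrt_two_mul_self : ((Real.sqrt 2 : ℝ) : ℂ) * ((Real.sqrt 2 : ℝ) : ℂ) = 2 := by
  rw [← Complex.ofReal_mul, Real.mul_self_sqrt (by norm_num)]
  norm_num

lemma bellProj_apply (i j : Fin 2) (p q : Fin 2 × Fin 2) :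
    bellProj i j p q =
      ((if p = (i, j) then 1 else 0) +
          (-1) ^ (i : ℕ) * (if p = (1 - i, 1 - j) then 1 else 0)) *
        ((if q = (i, j) then 1 else 0) +
          (-1) ^ (i : ℕ) * (if q = (1 - i, 1 - j) then 1 else 0)) / 2 := by
  have hstar : star (bellVec i j) q = bellVec i j q := by
    simp only [Pi.star_apply, bellVec, RCLike.star_def, map_div₀, map_add, map_mul, map_pow,
      map_neg, map_one, Complex.conj_ofReal, apply_ite (starRingEnd ℂ), map_zero]
  rw [bellProj, vecMulVec_apply, hstar, bellVec, bellVec, div_mul_div_comm,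
    ofReal_sqrt_two_mul_self]

lemma bellProj_parity :
    bellProj 0 0 - bellProj 0 1 - bellProj 1 0 + bellProj 1 1 = pauliZ ⊗ₖ pauliZ := by
  ext ⟨a, b⟩ ⟨c, d⟩
  simp only [Matrix.add_apply, Matrix.sub_apply, bellProj_apply, kroneckerMap_apply]
  fin_cases a <;> fin_cases b <;> fin_cases c <;> fin_cases d <;> norm_num [pauliZ]

lemma bellProj_phase :
    bellProj 0 0 + bellProj 0 1 - bellProj 1 0 - bellProj 1 1 = pauliX ⊗ₖ pauliX := by
  ext ⟨a, b⟩ ⟨c, d⟩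
  simp only [Matrix.add_apply, Matrix.sub_apply, bellProj_apply, kroneckerMap_apply]
  fin_cases a <;> fin_cases b <;> fin_cases c <;> fin_cases d <;> norm_num [pauliX]

/-- On two maximally entangled pairs, the expectation of local operators factorizes. -/
lemma expectation_ψABE (A B C D : Matrix (Fin 2) (Fin 2) ℂ) :
    star ψABE ⬝ᵥ (A ⊗ₖ (B ⊗ₖ (C ⊗ₖ D))) *ᵥ ψABE =
      (A * Cᵀ).trace / 2 * ((B * Dᵀ).trace / 2) := by
  have hconj : (starRingEnd ℂ) 2 = 2 := map_ofNat _ 2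
  simp [dotProduct, mulVec, ψABE, Fintype.sum_prod_type, Fin.sum_univ_two, trace, mul_apply,
    hconj]
  ring

/-- The quantum violation of classical independence: the above state and the
CHSH-optimal observables attain the value `2√2` of the weak-bilocality
functional `I = ⟨A₀(B₀−B₁)ℰ₀ + A₁(B₀+B₁)ℰ₁⟩`. -/
theorem quantum_violation_classical_independence :
    star ψABE ⬝ᵥ
        ((pauliZ ⊗ₖ
            ((((Real.sqrt 2 : ℝ)⁻¹ • (pauliZ + pauliX))
              - ((Real.sqrt 2 : ℝ)⁻¹ • (pauliX - pauliZ))) ⊗ₖ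
              (bellProj 0 0 - bellProj 0 1 - bellProj 1 0 + bellProj 1 1))
          + pauliX ⊗ₖ
            ((((Real.sqrt 2 : ℝ)⁻¹ • (pauliZ + pauliX))
              + ((Real.sqrt 2 : ℝ)⁻¹ • (pauliX - pauliZ))) ⊗ₖ
              (bellProj 0 0 + bellProj 0 1 - bellProj 1 0 - bellProj 1 1))).mulVec
          ψABE)
      = ((2 * Real.sqrt 2 : ℝ) : ℂ) := by
  have hs : ((Real.sqrt 2 : ℝ) : ℂ) ≠ 0 := by simp
  have hinv : ((Real.sqrt 2 : ℝ)⁻¹ : ℂ) * 2 = (Real.sqrt 2 : ℝ) := by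
    rw [← ofReal_sqrt_two_mul_self, inv_mul_cancel_left₀ hs]
  rw [bellProj_parity, bellProj_phase, add_mulVec, dotProduct_add, expectation_ψABE,
    expectation_ψABE]
  simp only [trace_fin_two, mul_apply, Fin.sum_univ_two, transpose_apply]
  simp [pauliZ, pauliX]
  linear_combination 2 * hinv
end

section
/- Let d_A'', d_B'', d_Ā'', d_B̄'' be positive integers and set d_A = 2d_A'', d_B = 2d_B'', d_E = 4·d_Ā''·d_B̄''. Let |ψ⟩ be a unit vector in ℂ^{d_A} ⊗ ℂ^{d_B} ⊗ ℂ^{d_E} whose reduced density matrices on each factor are full rank; let A₀, A₁ be Hermitian d_A × d_A matrices and B₀, B₁ Hermitian d_B × d_B matrices with A_x² ≤ 𝟙 and B_y² ≤ 𝟙; let {N_{ij}}_{i,j∈{0,1}} be positive semidefinite d_E × d_E matrices with ∑_{i,j} N_{ij} = 𝟙. Assume: (a) operational independence, ⟨ψ|(X ⊗ Y ⊗ 𝟙)|ψ⟩ = ⟨ψ|(X ⊗ 𝟙 ⊗ 𝟙)|ψ⟩ · ⟨ψ|(𝟙 ⊗ Y ⊗ 𝟙)|ψ⟩ for all matrices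 X (d_A × d_A) and Y (d_B × d_B); and (b) maximal violation, ⟨ψ| ( A₀ ⊗ (B₀−B₁) ⊗ ℰ₀ + A₁ ⊗ (B₀+B₁) ⊗ ℰ₁ ) |ψ⟩ = 2√2, where ℰ₀ = N_{00} − N_{01} − N_{10} + N_{11} and ℰ₁ = N_{00} + N_{01} − N_{10} − N_{11}. Then there exist unitaries U_A : ℂ^{d_A} → ℂ² ⊗ ℂ^{d_A''}, U_B : ℂ^{d_B} → ℂ² ⊗ ℂ^{d_B''}, U_E : ℂ^{d_E} → (ℂ² ⊗ ℂ²) ⊗ (ℂ^{d_Ā''} ⊗ ℂ^{d_B̄''}) and a unit vector |ξ⟩ ∈ ℂ^{d_A''} ⊗ ℂ^{d_B''} ⊗ ℂ^{d_Ā''} ⊗ ℂ^{d_B̄''} such that, after the canonical permutation of tensor factors, (U_A ⊗ U_B ⊗ U_E)|ψ⟩ equals |φ⁺⟩_{A'Ā'} ⊗ |φ⁺⟩_{B'B̄'} ⊗ |ξ⟩ with |φ⁺⟩ = (|00⟩+|11⟩)/√2, and moreover U_A A₀ U_A† = σ_z ⊗ 𝟙, U_A A₁ U_A† = σ_x ⊗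 𝟙, U_B B₀ U_B† = ((σ_z+σ_x)/√2) ⊗ 𝟙, U_B B₁ U_B† = ((σ_x−σ_z)/√2) ⊗ 𝟙, and U_E N_{ij} U_E† = |φ_{ij}⟩⟨φ_{ij}| ⊗ 𝟙 for all i,j, where |φ_{ij}⟩ = (|i,j⟩ + (−1)^i |1−i,1−j⟩)/√2 are the Bell states. -/
open Matrix Kronecker
open scoped ComplexOrder

namespace Matrix

section Generic

variable {n m : Type*} [Fintype n]

open scoped MatrixOrder Matrix.Norms.L2Operator in
lemma PosSemidef.exists_eq_conjTranspose_mul_self [DecidableEq n] {P : Matrix n n ℂ}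
    (hP : P.PosSemidef) : ∃ S : Matrix n n ℂ, P = Sᴴ * S :=
  CStarAlgebra.nonneg_iff_eq_star_mul_self.mp hP.nonneg

lemma PosSemidef.mul_eq_zero_of_conjTranspose_mul_mul_same {P : Matrix n n ℂ}
    (hP : P.PosSemidef) {C : Matrix n m ℂ} (h : Cᴴ * P * C = 0) : P * C = 0 := by
  classical
  obtain ⟨S, rfl⟩ := hP.exists_eq_conjTranspose_mul_self
  have : (S * C)ᴴ * (S * C) = 0 := by
    rw [conjTranspose_mul, ← h]; simp only [Matrix.mul_assoc]
  rw [Matrix.mul_assoc, conjTranspose_mul_self_eq_zero.mp this, Matrix.mul_zero]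

lemma PosSemidef.eq_zero_of_add_eq_zero {P Q : Matrix n n ℂ}
    (hP : P.PosSemidef) (hQ : Q.PosSemidef) (h : P + Q = 0) : P = 0 := by
  have h1 := hP.trace_nonneg
  have h2 := hQ.trace_nonneg
  have h3 : P.trace + Q.trace = 0 := by rw [← trace_add, h, trace_zero]
  exact hP.trace_eq_zero_iff.mp ((add_eq_zero_iff_of_nonneg h1 h2).mp h3).1

lemma PosSemidef.mulVec_eq_zero_of_dotProduct_add {P Q : Matrix n n ℂ}
    (hP : P.PosSemidef) (hQ : Q.PosSemidef) {v : n → ℂ}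
    (h : star v ⬝ᵥ ((P + Q) *ᵥ v) = 0) : P *ᵥ v = 0 := by
  have h1 := hP.dotProduct_mulVec_nonneg v
  have h2 := hQ.dotProduct_mulVec_nonneg v
  rw [add_mulVec, dotProduct_add] at h
  exact (hP.dotProduct_mulVec_zero_iff v).mp ((add_eq_zero_iff_of_nonneg h1 h2).mp h).1

variable [DecidableEq n]

/-- If `P` and `Q` are contractions, so is `P * Q`. -/
lemma PosSemidef.one_sub_mul_mul {P Q : Matrix n n ℂ} (hP : P.IsHermitian)
    (hP1 : (1 - P * P).PosSemidef) (hQ1 : (1 - Q * Q).PosSemidef) :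
    ((1 - P * P) + P * (1 - Q * Q) * P).PosSemidef := by
  refine hP1.add ?_
  simpa [hP.eq] using hQ1.conjTranspose_mul_mul_same P

/-- Four positive semidefinite matrices summing to `1` whose two marginal observables are
involutions are the joint spectral projections of these observables. -/
lemma povm_eq_of_marginals_sq {N : Fin 2 → Fin 2 → Matrix n n ℂ}
    (hN : ∀ i j, (N i j).PosSemidef) (hsum : ∑ i, ∑ j, N i j = 1) {E F : Matrix n n ℂ}
    (hE : E = N 0 0 - N 0 1 - N 1 0 + N 1 1) (hF : F = N 0 0 + N 0 1 - N 1 0 - N 1 1)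
    (hE2 : E * E = 1) (hF2 : F * F = 1) :
    E * F = F * E ∧ (4 : ℂ) • N 0 0 = (1 + E) * (1 + F) ∧
      (4 : ℂ) • N 0 1 = (1 - E) * (1 + F) ∧ (4 : ℂ) • N 1 0 = (1 - E) * (1 - F) ∧
      (4 : ℂ) • N 1 1 = (1 + E) * (1 - F) := by
  have key : ∀ {P Q G : Matrix n n ℂ}, P.PosSemidef → Q.PosSemidef → G * G = 1 →
      (2 : ℂ) • (P + Q) = 1 + G → P * G = P := by
    intro P Q G hP hQ hG2 hPQ
    have hG : Gᴴ = G := by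
      have h := congrArg conjTranspose hPQ
      rw [conjTranspose_smul, conjTranspose_add, hP.1.eq, hQ.1.eq] at h
      have h' : (1 : Matrix n n ℂ) + Gᴴ = 1 + G := by
        rw [← hPQ]; simpa using h.symm
      exact add_left_cancel h'
    have hC : (1 - G)ᴴ = 1 - G := by simp [hG]
    have h0 : (1 - G)ᴴ * P * (1 - G) + (1 - G)ᴴ * Q * (1 - G) = 0 := by
      have : (2 : ℂ) • ((1 - G)ᴴ * P * (1 - G) + (1 - G)ᴴ * Q * (1 - G)) = 0 := by
        rw [← Matrix.add_mul, ← Matrix.mul_add, ← Matrix.smul_mul, ← Matrix.mul_smul, hPQ, hC]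
        have : (1 - G) * (1 + G) = 0 := by
          rw [sub_mul, mul_add, mul_add, hG2]; simp only [one_mul, mul_one]; abel
        rw [this, Matrix.zero_mul]
      exact (smul_eq_zero.mp this).resolve_left two_ne_zero
    have := (hP.conjTranspose_mul_mul_same (1 - G)).eq_zero_of_add_eq_zero
      (hQ.conjTranspose_mul_mul_same (1 - G)) h0
    have := hP.mul_eq_zero_of_conjTranspose_mul_mul_same this
    rw [mul_sub, mul_one, sub_eq_zero] at this
    exact this.symm
  have hone : (1 : Matrix n n ℂ) = N 0 0 + N 0 1 + (N 1 0 + N 1 1) := by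
    rw [← hsum]; simp [Fin.sum_univ_two]
  have nE2 : (-E) * (-E) = 1 := by simpa using hE2
  have nF2 : (-F) * (-F) = 1 := by simpa using hF2
  have a00 : N 0 0 * E = N 0 0 :=
    key (hN 0 0) (hN 1 1) hE2 (by rw [hE, hone]; module)
  have a11 : N 1 1 * E = N 1 1 :=
    key (hN 1 1) (hN 0 0) hE2 (by rw [hE, hone]; module)
  have a01 : N 0 1 * -E = N 0 1 :=
    key (hN 0 1) (hN 1 0) nE2 (by rw [hE, hone]; module)
  have a10 : N 1 0 * -E = N 1 0 :=
    key (hN 1 0) (hN 0 1) nE2 (by rw [hE, hone]; module)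
  have b00 : N 0 0 * F = N 0 0 :=
    key (hN 0 0) (hN 0 1) hF2 (by rw [hF, hone]; module)
  have b01 : N 0 1 * F = N 0 1 :=
    key (hN 0 1) (hN 0 0) hF2 (by rw [hF, hone]; module)
  have b10 : N 1 0 * -F = N 1 0 :=
    key (hN 1 0) (hN 1 1) nF2 (by rw [hF, hone]; module)
  have b11 : N 1 1 * -F = N 1 1 :=
    key (hN 1 1) (hN 1 0) nF2 (by rw [hF, hone]; module)
  rw [mul_neg, neg_eq_iff_eq_neg] at a01 a10 b10 b11
  have hEF : E * F = N 0 0 - N 0 1 + N 1 0 - N 1 1 := by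
    conv_lhs => rw [hE]
    rw [add_mul, sub_mul, sub_mul, b00, b01, b10, b11]; abel
  have hFE : F * E = N 0 0 - N 0 1 + N 1 0 - N 1 1 := by
    conv_lhs => rw [hF]
    rw [sub_mul, sub_mul, add_mul, a00, a01, a10, a11]; abel
  refine ⟨hEF.trans hFE.symm, ?_, ?_, ?_, ?_⟩ <;>
    simp only [add_mul, sub_mul, mul_add, mul_sub, one_mul, mul_one, hEF] <;>
    rw [hE, hF, hone] <;> module

/-- The marginal observable of a POVM is a contraction. -/
lemma PosSemidef.one_sub_sq_of_add_eq_one {P Q : Matrix n n ℂ} (hP : P.PosSemidef)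
    (hQ : Q.PosSemidef) (h : P + Q = 1) : (1 - (P - Q) * (P - Q)).PosSemidef := by
  obtain rfl : Q = 1 - P := by rw [← h]; abel
  have h1 := hQ.conjTranspose_mul_mul_same P
  have h2 := hP.conjTranspose_mul_mul_same (1 - P)
  have e : 1 - (P - (1 - P)) * (P - (1 - P)) =
      (4 : ℂ) • (P * (1 - P) * P + (1 - P) * P * (1 - P)) := by
    simp only [mul_sub, sub_mul, mul_one, one_mul]
    module
  rw [hP.1.eq] at h1
  rw [hQ.1.eq] at h2
  rw [e]
  exact (h1.add h2).smul (by norm_num)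

end Generic

end Matrix

/-- Equality case of the Tsirelson inequality for vectors. -/
lemma tsirelson_vectors_eq {E : Type*} [NormedAddCommGroup E] [InnerProductSpace ℂ E]
    {p q b c : E} (hp : ‖p‖ ≤ 1) (hq : ‖q‖ ≤ 1) (hb : ‖b‖ ≤ 1) (hc : ‖c‖ ≤ 1)
    (h : RCLike.re (inner ℂ p (b - c) + inner ℂ q (b + c)) = 2 * √2) :
    (√2 : ℂ) • p = b - c ∧ (√2 : ℂ) • q = b + c ∧ ‖p‖ = 1 ∧ ‖q‖ = 1 ∧ ‖b‖ = 1 ∧ ‖c‖ = 1 := by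
  have hs : √2 * √2 = 2 := Real.mul_self_sqrt (by norm_num)
  have hs0 : 0 < √2 := by positivity
  have e1 := norm_sub_sq (𝕜 := ℂ) ((√2 : ℂ) • p) (b - c)
  have e2 := norm_sub_sq (𝕜 := ℂ) ((√2 : ℂ) • q) (b + c)
  have e3 := parallelogram_law_with_norm ℂ b c
  have hr : ∀ x : E, ‖(√2 : ℂ) • x‖ = √2 * ‖x‖ := fun x => by
    rw [norm_smul]; simp
  have hi : ∀ x y : E, RCLike.re (inner ℂ ((√2 : ℂ) • x) y) = √2 * RCLike.re (inner ℂ x y) := by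
    intro x y
    rw [inner_smul_left]; simp
  rw [hr, hi, mul_pow, Real.sq_sqrt (by norm_num)] at e1 e2
  rw [map_add] at h
  have hp2 : ‖p‖ ^ 2 ≤ 1 := pow_le_one₀ (norm_nonneg _) hp
  have hq2 : ‖q‖ ^ 2 ≤ 1 := pow_le_one₀ (norm_nonneg _) hq
  have hb2 : ‖b‖ ^ 2 ≤ 1 := pow_le_one₀ (norm_nonneg _) hb
  have hc2 : ‖c‖ ^ 2 ≤ 1 := pow_le_one₀ (norm_nonneg _) hc
  have h4 : √2 * RCLike.re (inner ℂ p (b - c)) + √2 * RCLike.re (inner ℂ q (b + c)) = 4 := by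
    rw [← mul_add, h]; linarith
  have n1 := sq_nonneg ‖(√2 : ℂ) • p - (b - c)‖
  have n2 := sq_nonneg ‖(√2 : ℂ) • q - (b + c)‖
  have z : ∀ x : E, ‖x‖ ^ 2 = 0 → x = 0 := fun x hx => by simpa using hx
  have o : ∀ x : E, ‖x‖ ^ 2 = 1 → ‖x‖ = 1 := fun x hx =>
    (pow_eq_one_iff_of_nonneg (norm_nonneg x) two_ne_zero).mp hx
  refine ⟨sub_eq_zero.mp (z _ ?_), sub_eq_zero.mp (z _ ?_), o _ ?_, o _ ?_, o _ ?_, o _ ?_⟩ <;>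
    nlinarith

lemma pauliZ_conjTranspose : pauliZᴴ = pauliZ := by
  ext i j; fin_cases i <;> fin_cases j <;> simp [pauliZ]

lemma pauliX_conjTranspose : pauliXᴴ = pauliX := by
  ext i j; fin_cases i <;> fin_cases j <;> simp [pauliX]

namespace Matrix

/-- An involution of trace zero has an orthonormal frame of its `+1` eigenspace, which has half
the dimension. -/
lemma IsHermitian.exists_frame_of_mul_self_eq_one {m : ℕ}
    {Z : Matrix (Fin (2 * m)) (Fin (2 * m)) ℂ} (hZ : Z.IsHermitian) (hZ2 : Z * Z = 1)
    (htr : Z.trace = 0) :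
    ∃ V : Matrix (Fin (2 * m)) (Fin m) ℂ, Vᴴ * V = 1 ∧ Z * V = V := by
  classical
  set U : Matrix (Fin (2 * m)) (Fin (2 * m)) ℂ :=
    hZ.eigenvectorUnitary.1 with hU
  have hUU : Uᴴ * U = 1 := Unitary.coe_star_mul_self hZ.eigenvectorUnitary
  have hcol : ∀ j, Z *ᵥ (fun i => U i j) = (hZ.eigenvalues j : ℂ) • fun i => U i j := by
    intro j
    have := hZ.mulVec_eigenvectorBasis j
    simpa [hU] using! this
  have hev : ∀ j, hZ.eigenvalues j = 1 ∨ hZ.eigenvalues j = -1 := by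
    intro j
    have h1 : (fun i => U i j) = ((hZ.eigenvalues j : ℂ) * hZ.eigenvalues j) • fun i => U i j := by
      conv_lhs => rw [← one_mulVec (fun i => U i j), ← hZ2, ← mulVec_mulVec, hcol, mulVec_smul,
        hcol, smul_smul]
    have h2 : ∑ i, star (U i j) * U i j = 1 := by
      have := congrFun (congrFun hUU j) j
      simpa [mul_apply] using this
    have h3 : ((hZ.eigenvalues j : ℂ) * hZ.eigenvalues j) = 1 := by
      have : ∑ i, star (U i j) * U i j =
          ((hZ.eigenvalues j : ℂ) * hZ.eigenvalues j) * ∑ i, star (U i j) * U i j := by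
        rw [Finset.mul_sum]
        refine Finset.sum_congr rfl fun i _ => ?_
        have h4 := congrFun h1 i
        simp only [Pi.smul_apply, smul_eq_mul] at h4
        rw [mul_left_comm, ← h4]
      rw [h2, mul_one] at this
      exact this.symm
    exact mul_self_eq_one_iff.mp (by exact_mod_cast h3)
  have hcard : Fintype.card {j // hZ.eigenvalues j = 1} = m := by
    have h1 : ∑ j, hZ.eigenvalues j = 0 := by
      have := hZ.trace_eq_sum_eigenvalues
      rw [htr] at this
      exact Complex.ofReal_eq_zero.mp (by simpa using this.symm)
    have h2 : ∀ j, hZ.eigenvalues j = 2 * (if hZ.eigenvalues j = 1 then 1 else 0) - 1 := by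
      intro j
      rcases hev j with h | h <;> rw [h] <;> norm_num
    rw [Finset.sum_congr rfl fun j _ => h2 j, Finset.sum_sub_distrib, ← Finset.mul_sum,
      Finset.sum_boole] at h1
    rw [Fintype.card_subtype]
    simp only [Finset.sum_const, Finset.card_univ, Fintype.card_fin, nsmul_eq_mul, mul_one] at h1
    push_cast at h1
    have : ((Finset.univ.filter fun j => hZ.eigenvalues j = 1).card : ℝ) = m := by linarith
    exact_mod_cast this
  let f : Fin m ≃ {j // hZ.eigenvalues j = 1} := (Fintype.equivFinOfCardEq hcard).symm
  refine ⟨U.submatrix id fun k => (f k : Fin (2 * m)), ?_, ?_⟩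
  · rw [conjTranspose_submatrix, ← submatrix_mul _ _ _ _ _ Function.bijective_id, hUU]
    exact submatrix_one _ (Subtype.val_injective.comp f.injective)
  · ext i k
    have := congrFun (hcol (f k)) i
    rw [(f k).2] at this
    simpa [mul_apply, mulVec, dotProduct] using this

/-- Two anticommuting Hermitian involutions are unitarily equivalent to the Pauli matrices
`σ_z` and `σ_x` tensored with an identity. -/
lemma exists_unitary_pauli {m : ℕ} {Z X : Matrix (Fin (2 * m)) (Fin (2 * m)) ℂ}
    (hZ : Z.IsHermitian) (hX : X.IsHermitian) (hZ2 : Z * Z = 1) (hX2 : X * X = 1)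
    (hZX : Z * X + X * Z = 0) :
    ∃ U : Matrix (Fin 2 × Fin m) (Fin (2 * m)) ℂ, U * Uᴴ = 1 ∧ Uᴴ * U = 1 ∧
      U * Z * Uᴴ = pauliZ ⊗ₖ (1 : Matrix (Fin m) (Fin m) ℂ) ∧
      U * X * Uᴴ = pauliX ⊗ₖ (1 : Matrix (Fin m) (Fin m) ℂ) := by
  have hZX' : Z * X = -(X * Z) := eq_neg_of_add_eq_zero_left hZX
  have htr : Z.trace = 0 := by
    have h1 : Z.trace = (X * (Z * X)).trace := by
      rw [trace_mul_comm, Matrix.mul_assoc, hX2, Matrix.mul_one]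
    rw [hZX', Matrix.mul_neg, ← Matrix.mul_assoc, hX2, Matrix.one_mul, trace_neg] at h1
    exact self_eq_neg.mp h1
  obtain ⟨V, hVV, hZV⟩ := hZ.exists_frame_of_mul_self_eq_one hZ2 htr
  have hVZ : Vᴴ * Z = Vᴴ := by
    conv_rhs => rw [← hZV, conjTranspose_mul, hZ.eq]
  have hVXV : Vᴴ * (X * V) = 0 := by
    have : Vᴴ * (X * V) = -(Vᴴ * (X * V)) := by
      conv_lhs => rw [← hVZ, Matrix.mul_assoc, ← Matrix.mul_assoc Z, hZX', Matrix.neg_mul,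
        Matrix.mul_assoc X, hZV, Matrix.mul_neg]
    ext i j
    exact self_eq_neg.mp (congrFun (congrFun this i) j)
  have hZXV : Z * (X * V) = -(X * V) := by
    rw [← Matrix.mul_assoc, hZX', Matrix.neg_mul, Matrix.mul_assoc, hZV]
  have hXXV : X * (X * V) = V := by rw [← Matrix.mul_assoc, hX2, Matrix.one_mul]
  let F : Fin 2 → Matrix (Fin (2 * m)) (Fin m) ℂ := ![V, X * V]
  let U : Matrix (Fin 2 × Fin m) (Fin (2 * m)) ℂ := of fun p i => star (F p.1 i p.2)
  have hconj : ∀ (Y : Matrix (Fin (2 * m)) (Fin (2 * m)) ℂ) (p q : Fin 2 × Fin m),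
      (U * Y * Uᴴ) p q = ((F p.1)ᴴ * (Y * F q.1)) p.2 q.2 := by
    intro Y p q
    rw [Matrix.mul_assoc]
    simp [U, mul_apply]
  have h1 : U * Uᴴ = 1 := by
    ext ⟨p, k⟩ ⟨q, l⟩
    have := hconj 1 (p, k) (q, l)
    rw [Matrix.mul_one, Matrix.one_mul] at this
    rw [this]
    fin_cases p <;> fin_cases q <;>
      simp [F, hVV, hVXV, conjTranspose_mul, hX.eq, Matrix.mul_assoc, hXXV, one_apply]
  refine ⟨U, h1, (mul_eq_one_comm_of_card_eq _ _ _ (by simp)).mp h1, ?_, ?_⟩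
  · ext ⟨p, k⟩ ⟨q, l⟩
    rw [hconj]
    fin_cases p <;> fin_cases q <;>
      simp [F, hVV, hVXV, conjTranspose_mul, hX.eq, Matrix.mul_assoc, hXXV, hZV, hZXV, pauliZ,
        one_apply]
    split_ifs <;> simp
  · ext ⟨p, k⟩ ⟨q, l⟩
    rw [hconj]
    fin_cases p <;> fin_cases q <;>
      simp [F, hVV, hVXV, conjTranspose_mul, hX.eq, Matrix.mul_assoc, hXXV, pauliX, one_apply]

/-- The commutant of `σ_z ⊗ 1` and `σ_x ⊗ 1` is `1 ⊗ M_m`. -/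
lemma eq_one_kronecker_of_commute_pauli {m : Type*} [Fintype m] [DecidableEq m]
    {R : Matrix (Fin 2 × m) (Fin 2 × m) ℂ}
    (hZ : (pauliZ ⊗ₖ (1 : Matrix m m ℂ)) * R = R * (pauliZ ⊗ₖ (1 : Matrix m m ℂ)))
    (hX : (pauliX ⊗ₖ (1 : Matrix m m ℂ)) * R = R * (pauliX ⊗ₖ (1 : Matrix m m ℂ))) :
    R = (1 : Matrix (Fin 2) (Fin 2) ℂ) ⊗ₖ R.submatrix (Prod.mk 0) (Prod.mk 0) := by
  have eZ : ∀ p q k l, (∑ x, pauliZ p x * R (x, k) (q, l)) = ∑ x, R (p, k) (x, l) * pauliZ x q := by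
    intro p q k l
    have := congrFun (congrFun hZ (p, k)) (q, l)
    simpa [mul_apply, Fintype.sum_prod_type, one_apply] using this
  have eX : ∀ p q k l, (∑ x, pauliX p x * R (x, k) (q, l)) = ∑ x, R (p, k) (x, l) * pauliX x q := by
    intro p q k l
    have := congrFun (congrFun hX (p, k)) (q, l)
    simpa [mul_apply, Fintype.sum_prod_type, one_apply] using this
  have h01 : ∀ k l, R (0, k) (1, l) = 0 := fun k l => by
    have := eZ 0 1 k l
    simpa [pauliZ, Fin.sum_univ_two, self_eq_neg] using this
  have h10 : ∀ k l, R (1, k) (0, l) = 0 := fun k l => by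
    have := eZ 1 0 k l
    simpa [pauliZ, Fin.sum_univ_two, neg_eq_self] using this
  have h11 : ∀ k l, R (1, k) (1, l) = R (0, k) (0, l) := fun k l => by
    have := eX 0 1 k l
    simpa [pauliX, Fin.sum_univ_two] using this
  ext ⟨p, k⟩ ⟨q, l⟩
  fin_cases p <;> fin_cases q <;> simp [h01, h10, h11]

/-- A positive definite matrix commuting with two anticommuting involutions is, in the basis
where these are Pauli matrices, of the form `1 ⊗ T Tᴴ`. -/
lemma exists_unitary_pauli_of_commute {m : ℕ} {Z X R : Matrix (Fin (2 * m)) (Fin (2 * m)) ℂ}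
    (hZ : Z.IsHermitian) (hX : X.IsHermitian) (hZ2 : Z * Z = 1) (hX2 : X * X = 1)
    (hZX : Z * X + X * Z = 0) (hR : R.PosSemidef) (hdet : R.det ≠ 0)
    (hRZ : Z * R = R * Z) (hRX : X * R = R * X) :
    ∃ (U : Matrix (Fin 2 × Fin m) (Fin (2 * m)) ℂ) (T : Matrix (Fin m) (Fin m) ℂ),
      U * Uᴴ = 1 ∧ Uᴴ * U = 1 ∧
      U * Z * Uᴴ = pauliZ ⊗ₖ (1 : Matrix (Fin m) (Fin m) ℂ) ∧
      U * X * Uᴴ = pauliX ⊗ₖ (1 : Matrix (Fin m) (Fin m) ℂ) ∧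
      T.det ≠ 0 ∧ U * R * Uᴴ = (1 : Matrix (Fin 2) (Fin 2) ℂ) ⊗ₖ (T * Tᴴ) := by
  obtain ⟨U, h1, h2, h3, h4⟩ := exists_unitary_pauli hZ hX hZ2 hX2 hZX
  have hconj : ∀ Y W : Matrix (Fin (2 * m)) (Fin (2 * m)) ℂ,
      (U * Y * Uᴴ) * (U * W * Uᴴ) = U * (Y * W) * Uᴴ := by
    intro Y W
    calc (U * Y * Uᴴ) * (U * W * Uᴴ) = U * Y * (Uᴴ * U) * W * Uᴴ := by
          simp only [Matrix.mul_assoc]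
      _ = _ := by rw [h2, Matrix.mul_one, Matrix.mul_assoc U]
  have hform := eq_one_kronecker_of_commute_pauli (R := U * R * Uᴴ)
    (by rw [← h3, hconj, hconj, hRZ]) (by rw [← h4, hconj, hconj, hRX])
  have hpos := (hR.mul_mul_conjTranspose_same U).submatrix (Prod.mk (0 : Fin 2))
  obtain ⟨S, hS⟩ := hpos.exists_eq_conjTranspose_mul_self
  rw [hS] at hform
  refine ⟨U, Sᴴ, h1, h2, h3, h4, fun h0 => ?_, by rw [hform, conjTranspose_conjTranspose]⟩
  have hunit : IsUnit (U * R * Uᴴ).det := by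
    have hRu : R * R⁻¹ = 1 := mul_nonsing_inv _ (isUnit_iff_ne_zero.mpr hdet)
    refine isUnit_det_of_right_inverse (B := U * R⁻¹ * Uᴴ) ?_
    rw [hconj, hRu, Matrix.mul_one, h1]
  rw [hform, det_kronecker, det_mul, h0] at hunit
  rcases Nat.eq_zero_or_pos m with rfl | hm
  · simp at h0
  · simp at hunit

end Matrix

namespace Matrix

section Expectation

variable {n : Type*} [Fintype n]

lemma inner_toLp_mulVec (P Q : Matrix n n ℂ) (v : n → ℂ) :
    inner ℂ (WithLp.toLp 2 (P *ᵥ v)) (WithLp.toLp 2 (Q *ᵥ v)) =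
      star v ⬝ᵥ ((Pᴴ * Q) *ᵥ v) := by
  rw [EuclideanSpace.inner_toLp_toLp, dotProduct_comm, star_mulVec, ← mulVec_mulVec,
    dotProduct_mulVec (star v) Pᴴ]

variable [DecidableEq n]

lemma IsHermitian.dotProduct_one_sub_sq {K : Matrix n n ℂ} (hK : K.IsHermitian) {v : n → ℂ}
    (hv : star v ⬝ᵥ v = 1) :
    star v ⬝ᵥ ((1 - K * K) *ᵥ v) = ((1 - ‖WithLp.toLp 2 (K *ᵥ v)‖ ^ 2 : ℝ) : ℂ) := by
  have := inner_toLp_mulVec K K v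
  rw [inner_self_eq_norm_sq_to_K, hK.eq] at this
  rw [sub_mulVec, dotProduct_sub, one_mulVec, hv, ← this]
  simp

lemma norm_mulVec_le_one {K : Matrix n n ℂ} (hK : K.IsHermitian)
    (hK1 : (1 - K * K).PosSemidef) {v : n → ℂ} (hv : star v ⬝ᵥ v = 1) :
    ‖WithLp.toLp 2 (K *ᵥ v)‖ ≤ 1 := by
  have h := hK1.dotProduct_mulVec_nonneg v
  rw [hK.dotProduct_one_sub_sq hv, Complex.zero_le_real] at h
  exact (sq_le_one_iff₀ (norm_nonneg _)).mp (by linarith)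

lemma dotProduct_one_sub_sq_eq_zero {K : Matrix n n ℂ} (hK : K.IsHermitian) {v : n → ℂ}
    (hv : star v ⬝ᵥ v = 1) (h : ‖WithLp.toLp 2 (K *ᵥ v)‖ = 1) :
    star v ⬝ᵥ ((1 - K * K) *ᵥ v) = 0 := by
  rw [hK.dotProduct_one_sub_sq hv, h]; simp

lemma one_sub_sq_mul_of_commute {P Q : Matrix n n ℂ} (hPQ : Commute P Q) :
    1 - P * Q * (P * Q) = (1 - P * P) + P * (1 - Q * Q) * P := by
  have : P * (Q * Q) * P = P * Q * (P * Q) := by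
    simp only [mul_assoc]
    rw [← hPQ.eq]
  rw [mul_sub, sub_mul, mul_one, this]; abel

/-- If a product of commuting contractions preserves the norm of a vector, so does the left
factor. -/
lemma one_sub_sq_mulVec_eq_zero {P Q : Matrix n n ℂ} (hPQ : Commute P Q) (hP : P.IsHermitian)
    (hP1 : (1 - P * P).PosSemidef) (hQ1 : (1 - Q * Q).PosSemidef) {v : n → ℂ}
    (h : star v ⬝ᵥ ((1 - P * Q * (P * Q)) *ᵥ v) = 0) : (1 - P * P) *ᵥ v = 0 := by
  rw [one_sub_sq_mul_of_commute hPQ] at h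
  refine hP1.mulVec_eq_zero_of_dotProduct_add ?_ h
  simpa [hP.eq] using hQ1.conjTranspose_mul_mul_same P

/-- Equality case of the sum-of-squares proof of the Tsirelson bound. -/
lemma tsirelson_equality {a₀ a₁ b₀ b₁ e₀ e₁ : Matrix n n ℂ}
    (ha₀ : a₀.IsHermitian) (ha₁ : a₁.IsHermitian) (hb₀ : b₀.IsHermitian) (hb₁ : b₁.IsHermitian)
    (he₀ : e₀.IsHermitian) (he₁ : e₁.IsHermitian)
    (ha₀1 : (1 - a₀ * a₀).PosSemidef) (ha₁1 : (1 - a₁ * a₁).PosSemidef)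
    (hb₀1 : (1 - b₀ * b₀).PosSemidef) (hb₁1 : (1 - b₁ * b₁).PosSemidef)
    (he₀1 : (1 - e₀ * e₀).PosSemidef) (he₁1 : (1 - e₁ * e₁).PosSemidef)
    (hc₀ : Commute a₀ e₀) (hc₁ : Commute a₁ e₁) {v : n → ℂ} (hv : star v ⬝ᵥ v = 1)
    (h : star v ⬝ᵥ ((a₀ * e₀ * (b₀ - b₁) + a₁ * e₁ * (b₀ + b₁)) *ᵥ v) =
      ((2 * √2 : ℝ) : ℂ)) :
    (1 - a₀ * a₀) *ᵥ v = 0 ∧ (1 - a₁ * a₁) *ᵥ v = 0 ∧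
    (1 - b₀ * b₀) *ᵥ v = 0 ∧ (1 - b₁ * b₁) *ᵥ v = 0 ∧
    (1 - e₀ * e₀) *ᵥ v = 0 ∧ (1 - e₁ * e₁) *ᵥ v = 0 ∧
    (a₀ * e₀) *ᵥ v = ((√2)⁻¹ • (b₀ - b₁)) *ᵥ v ∧
    (a₁ * e₁) *ᵥ v = ((√2)⁻¹ • (b₀ + b₁)) *ᵥ v := by
  have hp : (a₀ * e₀).IsHermitian := by
    rw [IsHermitian, conjTranspose_mul, ha₀.eq, he₀.eq, hc₀.eq]
  have hq : (a₁ * e₁).IsHermitian := by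
    rw [IsHermitian, conjTranspose_mul, ha₁.eq, he₁.eq, hc₁.eq]
  have hp1 : (1 - a₀ * e₀ * (a₀ * e₀)).PosSemidef := by
    rw [one_sub_sq_mul_of_commute hc₀]; exact PosSemidef.one_sub_mul_mul ha₀ ha₀1 he₀1
  have hq1 : (1 - a₁ * e₁ * (a₁ * e₁)).PosSemidef := by
    rw [one_sub_sq_mul_of_commute hc₁]; exact PosSemidef.one_sub_mul_mul ha₁ ha₁1 he₁1
  have key := tsirelson_vectors_eq (norm_mulVec_le_one hp hp1 hv) (norm_mulVec_le_one hq hq1 hv)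
    (norm_mulVec_le_one hb₀ hb₀1 hv) (norm_mulVec_le_one hb₁ hb₁1 hv) (by
      rw [← WithLp.toLp_sub, ← WithLp.toLp_add, ← sub_mulVec, ← add_mulVec, inner_toLp_mulVec,
        inner_toLp_mulVec, hp.eq, hq.eq, ← dotProduct_add, ← add_mulVec, h]
      exact Complex.ofReal_re _)
  obtain ⟨k1, k2, k3, k4, k5, k6⟩ := key
  have h3 := dotProduct_one_sub_sq_eq_zero hp hv k3
  have h4 := dotProduct_one_sub_sq_eq_zero hq hv k4
  have hs : (√2 : ℂ) ≠ 0 := by simp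
  have scale : ∀ {x y : n → ℂ} (_ : (√2 : ℂ) • x = y), x = (√2)⁻¹ • y := by
    rintro x _ rfl
    ext i
    simp [hs]
  refine ⟨one_sub_sq_mulVec_eq_zero hc₀ ha₀ ha₀1 he₀1 h3,
    one_sub_sq_mulVec_eq_zero hc₁ ha₁ ha₁1 he₁1 h4,
    (hb₀1.dotProduct_mulVec_zero_iff v).mp (dotProduct_one_sub_sq_eq_zero hb₀ hv k5),
    (hb₁1.dotProduct_mulVec_zero_iff v).mp (dotProduct_one_sub_sq_eq_zero hb₁ hv k6),
    one_sub_sq_mulVec_eq_zero hc₀.symm he₀ he₀1 ha₀1 (by rwa [← hc₀.eq]),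
    one_sub_sq_mulVec_eq_zero hc₁.symm he₁ he₁1 ha₁1 (by rwa [← hc₁.eq]), ?_, ?_⟩
  · rw [smul_mulVec]
    refine scale ?_
    rw [sub_mulVec]
    exact congrArg WithLp.ofLp k1
  · rw [smul_mulVec]
    refine scale ?_
    rw [add_mulVec]
    exact congrArg WithLp.ofLp k2

end Expectation

section Bipartite

variable {a b e : Type*} [Fintype a] [Fintype b] [Fintype e]

lemma of_curry_kronecker_mulVec (X : Matrix a a ℂ) (Y : Matrix b b ℂ) (v : a × b → ℂ) :
    of (Function.curry ((X ⊗ₖ Y) *ᵥ v)) = X * of (Function.curry v) * Yᵀ := by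
  ext i j
  simp only [of_apply, Function.curry, mulVec, dotProduct, kronecker_apply, mul_apply,
    transpose_apply, Fintype.sum_prod_type, Finset.sum_mul]
  rw [Finset.sum_comm]
  exact Finset.sum_congr rfl fun _ _ => Finset.sum_congr rfl fun _ _ => by ring

/-- A local operator annihilating a vector of full local rank vanishes. -/
lemma eq_zero_of_kronecker_one_mulVec [DecidableEq a] [DecidableEq b] {v : a × b → ℂ}
    (hv : (of (Function.curry v) * (of (Function.curry v))ᴴ).det ≠ 0) {X : Matrix a a ℂ}
    (h : (X ⊗ₖ (1 : Matrix b b ℂ)) *ᵥ v = 0) : X = 0 := by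
  have h1 : X * of (Function.curry v) = 0 := by
    have := of_curry_kronecker_mulVec X (1 : Matrix b b ℂ) v
    rw [h, transpose_one, Matrix.mul_one] at this
    rw [← this]; rfl
  have h2 : X * (of (Function.curry v) * (of (Function.curry v))ᴴ) = 0 := by
    rw [← Matrix.mul_assoc, h1, Matrix.zero_mul]
  rw [← Matrix.mul_one X, ← mul_nonsing_inv _ (isUnit_iff_ne_zero.mpr hv), ← Matrix.mul_assoc, h2,
    Matrix.zero_mul]

/-- A Hermitian local operator that can be transferred to a Hermitian operator on the other side
commutes with the reduced density matrix. -/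
lemma commute_reduced_of_kronecker_mulVec_eq [DecidableEq a] [DecidableEq b] {v : a × b → ℂ}
    {X : Matrix a a ℂ} {Y : Matrix b b ℂ} (hX : X.IsHermitian) (hY : Y.IsHermitian)
    (h : (X ⊗ₖ (1 : Matrix b b ℂ)) *ᵥ v = ((1 : Matrix a a ℂ) ⊗ₖ Y) *ᵥ v) :
    X * (of (Function.curry v) * (of (Function.curry v))ᴴ) =
      of (Function.curry v) * (of (Function.curry v))ᴴ * X := by
  have h1 : X * of (Function.curry v) = of (Function.curry v) * Yᵀ := by
    have := congrArg (fun w => of (Function.curry w)) h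
    simpa [of_curry_kronecker_mulVec] using this
  have h2 : Yᵀ * (of (Function.curry v))ᴴ = (of (Function.curry v))ᴴ * X := by
    have := congrArg conjTranspose h1
    rw [conjTranspose_mul, conjTranspose_mul, hX.eq, hY.transpose.eq] at this
    exact this.symm
  rw [← Matrix.mul_assoc, h1, Matrix.mul_assoc, h2, Matrix.mul_assoc]

lemma kronecker_mulVec_swapLeft (X : Matrix a a ℂ) (Y : Matrix b b ℂ) (W : Matrix e e ℂ)
    (v : a × b × e → ℂ) :
    (Y ⊗ₖ (X ⊗ₖ W)) *ᵥ (fun p : b × a × e => v (p.2.1, p.1, p.2.2)) =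
      fun p => ((X ⊗ₖ (Y ⊗ₖ W)) *ᵥ v) (p.2.1, p.1, p.2.2) := by
  ext ⟨j, i, k⟩
  simp only [mulVec, dotProduct, kronecker_apply, Fintype.sum_prod_type]
  rw [Finset.sum_comm]
  exact Finset.sum_congr rfl fun _ _ => Finset.sum_congr rfl fun _ _ =>
    Finset.sum_congr rfl fun _ _ => by ring

lemma kronecker_mulVec_rotate (X : Matrix a a ℂ) (Y : Matrix b b ℂ) (W : Matrix e e ℂ)
    (v : a × b × e → ℂ) :
    (W ⊗ₖ (X ⊗ₖ Y)) *ᵥ (fun p : e × a × b => v (p.2.1, p.2.2, p.1)) =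
      fun p => ((X ⊗ₖ (Y ⊗ₖ W)) *ᵥ v) (p.2.1, p.2.2, p.1) := by
  ext ⟨k, i, j⟩
  simp only [mulVec, dotProduct, kronecker_apply, Fintype.sum_prod_type]
  rw [Finset.sum_comm]
  refine Finset.sum_congr rfl fun _ _ => ?_
  rw [Finset.sum_comm]
  exact Finset.sum_congr rfl fun _ _ => Finset.sum_congr rfl fun _ _ => by ring

end Bipartite

/-- A purification of `1 ⊗ T Tᴴ` of full rank factors through a unitary. -/
lemma exists_unitary_purification {k g e : Type*} [Fintype k] [Fintype g] [Fintype e]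
    [DecidableEq k] [DecidableEq g] [DecidableEq e] {M : Matrix (k × g) e ℂ} {T : Matrix g g ℂ}
    (hT : T.det ≠ 0) (hM : M * Mᴴ = (1 : Matrix k k ℂ) ⊗ₖ (T * Tᴴ)) (hMM : (Mᴴ * M).det ≠ 0) :
    ∃ W : Matrix (k × g) e ℂ, W * Wᴴ = 1 ∧ Wᴴ * W = 1 ∧
      M = ((1 : Matrix k k ℂ) ⊗ₖ T) * W ∧
      ∀ (P : Matrix k k ℂ) (Q : Matrix e e ℂ),
        (P ⊗ₖ (1 : Matrix g g ℂ)) * M = M * Q → (P ⊗ₖ (1 : Matrix g g ℂ)) * W = W * Q := by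
  have hT1 : T * T⁻¹ = 1 := mul_nonsing_inv _ (isUnit_iff_ne_zero.mpr hT)
  have hT2 : T⁻¹ * T = 1 := nonsing_inv_mul _ (isUnit_iff_ne_zero.mpr hT)
  have hMW : M = ((1 : Matrix k k ℂ) ⊗ₖ T) * (((1 : Matrix k k ℂ) ⊗ₖ T⁻¹) * M) := by
    rw [← Matrix.mul_assoc, ← mul_kronecker_mul, hT1, Matrix.mul_one, one_kronecker_one,
      Matrix.one_mul]
  have hWW : (((1 : Matrix k k ℂ) ⊗ₖ T⁻¹) * M) * (((1 : Matrix k k ℂ) ⊗ₖ T⁻¹) * M)ᴴ = 1 := by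
    rw [conjTranspose_mul, Matrix.mul_assoc, ← Matrix.mul_assoc M, hM, conjTranspose_kronecker,
      ← mul_kronecker_mul, ← mul_kronecker_mul, Matrix.mul_assoc T, ← Matrix.mul_assoc T⁻¹ T, hT2,
      Matrix.one_mul, ← conjTranspose_mul, hT2]
    simp
  generalize hW : ((1 : Matrix k k ℂ) ⊗ₖ T⁻¹) * M = W at hMW hWW
  refine ⟨W, hWW, ?_, hMW, fun P Q h => ?_⟩
  · have h1 : Mᴴ * M * (Wᴴ * W) = Mᴴ * M := by
      have : M * (Wᴴ * W) = M := by
        rw [hMW, Matrix.mul_assoc, ← Matrix.mul_assoc W, hWW, Matrix.one_mul]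
      rw [Matrix.mul_assoc, this]
    rw [← Matrix.one_mul (Wᴴ * W), ← nonsing_inv_mul _ (isUnit_iff_ne_zero.mpr hMM),
      Matrix.mul_assoc, h1]
  · rw [← hW, Matrix.mul_assoc, ← h, ← Matrix.mul_assoc, ← Matrix.mul_assoc, ← mul_kronecker_mul,
      ← mul_kronecker_mul]
    simp

end Matrix

namespace Matrix

section Relations

variable {a b e : Type*}

lemma sub_kronecker_s10 (X Y : Matrix a a ℂ) (Z : Matrix b b ℂ) :
    (X - Y) ⊗ₖ Z = X ⊗ₖ Z - Y ⊗ₖ Z := by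
  ext; simp [sub_mul]

lemma kronecker_sub_s10 (X : Matrix a a ℂ) (Y Z : Matrix b b ℂ) :
    X ⊗ₖ (Y - Z) = X ⊗ₖ Y - X ⊗ₖ Z := by
  ext; simp [mul_sub]

variable [Fintype a] [Fintype b] [Fintype e]

lemma mulVec_kronecker_mul (X X' : Matrix a a ℂ) (Y Y' : Matrix b b ℂ) (W W' : Matrix e e ℂ)
    (v : a × b × e → ℂ) :
    (X ⊗ₖ (Y ⊗ₖ W)) *ᵥ ((X' ⊗ₖ (Y' ⊗ₖ W')) *ᵥ v) = ((X * X') ⊗ₖ ((Y * Y') ⊗ₖ (W * W'))) *ᵥ v := by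
  rw [mulVec_mulVec, ← mul_kronecker_mul, ← mul_kronecker_mul]

variable [DecidableEq a] [DecidableEq b] [DecidableEq e]

/-- Maximal violation of the weak-bilocality functional forces all observables to be involutions
which stabilise the state. -/
lemma weak_bilocality_stabilizer {ψ : a × b × e → ℂ} (hψ : star ψ ⬝ᵥ ψ = 1)
    (fA : ∀ X : Matrix a a ℂ,
      (X ⊗ₖ ((1 : Matrix b b ℂ) ⊗ₖ (1 : Matrix e e ℂ))) *ᵥ ψ = 0 → X = 0)
    (fB : ∀ Y : Matrix b b ℂ,
      ((1 : Matrix a a ℂ) ⊗ₖ (Y ⊗ₖ (1 : Matrix e e ℂ))) *ᵥ ψ = 0 → Y = 0)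
    (fE : ∀ W : Matrix e e ℂ,
      ((1 : Matrix a a ℂ) ⊗ₖ ((1 : Matrix b b ℂ) ⊗ₖ W)) *ᵥ ψ = 0 → W = 0)
    {A₀ A₁ : Matrix a a ℂ} {B₀ B₁ : Matrix b b ℂ} {E₀ E₁ : Matrix e e ℂ}
    (hA₀ : A₀.IsHermitian) (hA₁ : A₁.IsHermitian) (hB₀ : B₀.IsHermitian) (hB₁ : B₁.IsHermitian)
    (hE₀ : E₀.IsHermitian) (hE₁ : E₁.IsHermitian)
    (hA₀1 : (1 - A₀ * A₀).PosSemidef) (hA₁1 : (1 - A₁ * A₁).PosSemidef)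
    (hB₀1 : (1 - B₀ * B₀).PosSemidef) (hB₁1 : (1 - B₁ * B₁).PosSemidef)
    (hE₀1 : (1 - E₀ * E₀).PosSemidef) (hE₁1 : (1 - E₁ * E₁).PosSemidef)
    (hmax : star ψ ⬝ᵥ ((A₀ ⊗ₖ ((B₀ - B₁) ⊗ₖ E₀) + A₁ ⊗ₖ ((B₀ + B₁) ⊗ₖ E₁)) *ᵥ ψ) =
      ((2 * √2 : ℝ) : ℂ)) :
    A₀ * A₀ = 1 ∧ A₁ * A₁ = 1 ∧ B₀ * B₀ = 1 ∧ B₁ * B₁ = 1 ∧ E₀ * E₀ = 1 ∧ E₁ * E₁ = 1 ∧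
    (A₀ ⊗ₖ ((1 : Matrix b b ℂ) ⊗ₖ E₀)) *ᵥ ψ =
      ((1 : Matrix a a ℂ) ⊗ₖ (((√2)⁻¹ • (B₀ - B₁)) ⊗ₖ (1 : Matrix e e ℂ))) *ᵥ ψ ∧
    (A₁ ⊗ₖ ((1 : Matrix b b ℂ) ⊗ₖ E₁)) *ᵥ ψ =
      ((1 : Matrix a a ℂ) ⊗ₖ (((√2)⁻¹ • (B₀ + B₁)) ⊗ₖ (1 : Matrix e e ℂ))) *ᵥ ψ := by
  have one3 : (1 : Matrix (a × b × e) (a × b × e) ℂ) =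
      (1 : Matrix a a ℂ) ⊗ₖ ((1 : Matrix b b ℂ) ⊗ₖ (1 : Matrix e e ℂ)) := by
    rw [one_kronecker_one, one_kronecker_one]
  have herm : ∀ {X : Matrix a a ℂ} {Y : Matrix b b ℂ} {W : Matrix e e ℂ}, X.IsHermitian →
      Y.IsHermitian → W.IsHermitian → (X ⊗ₖ (Y ⊗ₖ W)).IsHermitian := by
    intro X Y W hX hY hW
    rw [IsHermitian, conjTranspose_kronecker, conjTranspose_kronecker, hX.eq, hY.eq, hW.eq]
  have sqA : ∀ X : Matrix a a ℂ, 1 - (X ⊗ₖ ((1 : Matrix b b ℂ) ⊗ₖ (1 : Matrix e e ℂ))) *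
      (X ⊗ₖ ((1 : Matrix b b ℂ) ⊗ₖ (1 : Matrix e e ℂ))) =
        (1 - X * X) ⊗ₖ ((1 : Matrix b b ℂ) ⊗ₖ (1 : Matrix e e ℂ)) := by
    intro X
    rw [← mul_kronecker_mul, ← mul_kronecker_mul, sub_kronecker_s10, ← one3, mul_one, mul_one]
  have sqB : ∀ Y : Matrix b b ℂ, 1 - ((1 : Matrix a a ℂ) ⊗ₖ (Y ⊗ₖ (1 : Matrix e e ℂ))) *
      ((1 : Matrix a a ℂ) ⊗ₖ (Y ⊗ₖ (1 : Matrix e e ℂ))) =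
        (1 : Matrix a a ℂ) ⊗ₖ ((1 - Y * Y) ⊗ₖ (1 : Matrix e e ℂ)) := by
    intro Y
    rw [← mul_kronecker_mul, ← mul_kronecker_mul, sub_kronecker_s10, kronecker_sub_s10, ← one3, mul_one,
      mul_one]
  have sqE : ∀ W : Matrix e e ℂ, 1 - ((1 : Matrix a a ℂ) ⊗ₖ ((1 : Matrix b b ℂ) ⊗ₖ W)) *
      ((1 : Matrix a a ℂ) ⊗ₖ ((1 : Matrix b b ℂ) ⊗ₖ W)) =
        (1 : Matrix a a ℂ) ⊗ₖ ((1 : Matrix b b ℂ) ⊗ₖ (1 - W * W)) := by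
    intro W
    rw [← mul_kronecker_mul, ← mul_kronecker_mul, kronecker_sub_s10, kronecker_sub_s10, ← one3, mul_one,
      mul_one]
  have comm : ∀ (X : Matrix a a ℂ) (W : Matrix e e ℂ),
      Commute (X ⊗ₖ ((1 : Matrix b b ℂ) ⊗ₖ (1 : Matrix e e ℂ)))
        ((1 : Matrix a a ℂ) ⊗ₖ ((1 : Matrix b b ℂ) ⊗ₖ W)) := by
    intro X W
    simp only [Commute, SemiconjBy, ← mul_kronecker_mul, mul_one, one_mul]
  have p1a := (PosSemidef.one (n := a) (R := ℂ))
  have p1b := (PosSemidef.one (n := b) (R := ℂ))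
  have p1e := (PosSemidef.one (n := e) (R := ℂ))
  have i1a := (isHermitian_one (n := a) (α := ℂ))
  have i1b := (isHermitian_one (n := b) (α := ℂ))
  have i1e := (isHermitian_one (n := e) (α := ℂ))
  obtain ⟨k1, k2, k3, k4, k5, k6, k7, k8⟩ := tsirelson_equality
    (herm hA₀ i1b i1e) (herm hA₁ i1b i1e) (herm i1a hB₀ i1e) (herm i1a hB₁ i1e)
    (herm i1a i1b hE₀) (herm i1a i1b hE₁)
    (by rw [sqA]; exact hA₀1.kronecker (p1b.kronecker p1e))
    (by rw [sqA]; exact hA₁1.kronecker (p1b.kronecker p1e))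
    (by rw [sqB]; exact p1a.kronecker (hB₀1.kronecker p1e))
    (by rw [sqB]; exact p1a.kronecker (hB₁1.kronecker p1e))
    (by rw [sqE]; exact p1a.kronecker (p1b.kronecker hE₀1))
    (by rw [sqE]; exact p1a.kronecker (p1b.kronecker hE₁1))
    (comm A₀ E₀) (comm A₁ E₁) hψ (by
      rw [← hmax]
      simp only [← kronecker_sub_s10, ← sub_kronecker_s10, ← kronecker_add, ← add_kronecker,
        ← mul_kronecker_mul, mul_one, one_mul])
  rw [sqA] at k1 k2
  rw [sqB] at k3 k4
  rw [sqE] at k5 k6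
  simp only [← kronecker_sub_s10, ← sub_kronecker_s10, ← kronecker_add, ← add_kronecker,
    ← mul_kronecker_mul, ← kronecker_smul, mul_one, one_mul] at k7 k8
  rw [kronecker_smul, ← smul_kronecker] at k7 k8
  exact ⟨(sub_eq_zero.mp (fA _ k1)).symm, (sub_eq_zero.mp (fA _ k2)).symm,
    (sub_eq_zero.mp (fB _ k3)).symm, (sub_eq_zero.mp (fB _ k4)).symm,
    (sub_eq_zero.mp (fE _ k5)).symm, (sub_eq_zero.mp (fE _ k6)).symm, k7, k8⟩

/-- Stabiliser relations make Bob's observables `(B₀ ∓ B₁)/√2` involutions and Alice's observables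
anticommute. -/
lemma anticommute_of_stabilizer {ψ : a × b × e → ℂ}
    (fA : ∀ X : Matrix a a ℂ,
      (X ⊗ₖ ((1 : Matrix b b ℂ) ⊗ₖ (1 : Matrix e e ℂ))) *ᵥ ψ = 0 → X = 0)
    (fB : ∀ Y : Matrix b b ℂ,
      ((1 : Matrix a a ℂ) ⊗ₖ (Y ⊗ₖ (1 : Matrix e e ℂ))) *ᵥ ψ = 0 → Y = 0)
    {A₀ A₁ : Matrix a a ℂ} {Z X : Matrix b b ℂ} {E₀ E₁ : Matrix e e ℂ}
    (hA₀ : A₀ * A₀ = 1) (hA₁ : A₁ * A₁ = 1) (hE₀ : E₀ * E₀ = 1) (hE₁ : E₁ * E₁ = 1)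
    (hE : E₀ * E₁ = E₁ * E₀) (hZX : Z * X + X * Z = 0)
    (hZ : (A₀ ⊗ₖ ((1 : Matrix b b ℂ) ⊗ₖ E₀)) *ᵥ ψ =
      ((1 : Matrix a a ℂ) ⊗ₖ (Z ⊗ₖ (1 : Matrix e e ℂ))) *ᵥ ψ)
    (hX : (A₁ ⊗ₖ ((1 : Matrix b b ℂ) ⊗ₖ E₁)) *ᵥ ψ =
      ((1 : Matrix a a ℂ) ⊗ₖ (X ⊗ₖ (1 : Matrix e e ℂ))) *ᵥ ψ) :
    Z * Z = 1 ∧ X * X = 1 ∧ A₀ * A₁ + A₁ * A₀ = 0 := by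
  have sq : ∀ {A : Matrix a a ℂ} {Y : Matrix b b ℂ} {E : Matrix e e ℂ}, A * A = 1 → E * E = 1 →
      (A ⊗ₖ ((1 : Matrix b b ℂ) ⊗ₖ E)) *ᵥ ψ =
        ((1 : Matrix a a ℂ) ⊗ₖ (Y ⊗ₖ (1 : Matrix e e ℂ))) *ᵥ ψ → Y * Y = 1 := by
    intro A Y E hA hE h
    have h1 := congrArg (fun w => ((1 : Matrix a a ℂ) ⊗ₖ (Y ⊗ₖ (1 : Matrix e e ℂ))) *ᵥ w) h
    have h2 := congrArg (fun w => (A ⊗ₖ ((1 : Matrix b b ℂ) ⊗ₖ E)) *ᵥ w) h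
    simp only [mulVec_kronecker_mul, mul_one, one_mul, hA, hE] at h1 h2
    refine sub_eq_zero.mp (fB _ ?_)
    rw [sub_kronecker_s10, kronecker_sub_s10, sub_mulVec, ← h1, h2, sub_self]
  refine ⟨sq hA₀ hE₀ hZ, sq hA₁ hE₁ hX, fA _ ?_⟩
  have h01 := congrArg (fun w => (A₀ ⊗ₖ ((1 : Matrix b b ℂ) ⊗ₖ E₀)) *ᵥ w) hX
  have h01' := congrArg (fun w => ((1 : Matrix a a ℂ) ⊗ₖ (X ⊗ₖ (1 : Matrix e e ℂ))) *ᵥ w) hZ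
  have h10 := congrArg (fun w => (A₁ ⊗ₖ ((1 : Matrix b b ℂ) ⊗ₖ E₁)) *ᵥ w) hZ
  have h10' := congrArg (fun w => ((1 : Matrix a a ℂ) ⊗ₖ (Z ⊗ₖ (1 : Matrix e e ℂ))) *ᵥ w) hX
  simp only [mulVec_kronecker_mul, mul_one, one_mul] at h01 h01' h10 h10'
  have h : ((A₀ * A₁ + A₁ * A₀) ⊗ₖ ((1 : Matrix b b ℂ) ⊗ₖ (E₀ * E₁))) *ᵥ ψ = 0 := by
    rw [add_kronecker, add_mulVec, h01, h01', hE, h10, h10', ← add_mulVec, ← kronecker_add,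
      ← add_kronecker, add_comm, hZX]
    simp
  have h' := congrArg
    (fun w => ((1 : Matrix a a ℂ) ⊗ₖ ((1 : Matrix b b ℂ) ⊗ₖ (E₀ * E₁))) *ᵥ w) h
  have hEE : E₀ * E₁ * (E₀ * E₁) = 1 := by
    nth_rw 2 [hE]
    rw [mul_assoc, ← mul_assoc E₁, hE₁, one_mul, hE₀]
  simpa only [mulVec_kronecker_mul, mul_one, one_mul, hEE, mulVec_zero] using h'

/-- Operational independence means that the reduced state of Alice and Bob is a product. -/
lemma reduced_eq_kronecker_of_independent {ψ : a × b × e → ℂ}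
    (h : ∀ (X : Matrix a a ℂ) (Y : Matrix b b ℂ),
      star ψ ⬝ᵥ ((X ⊗ₖ (Y ⊗ₖ (1 : Matrix e e ℂ))) *ᵥ ψ) =
        (star ψ ⬝ᵥ ((X ⊗ₖ ((1 : Matrix b b ℂ) ⊗ₖ (1 : Matrix e e ℂ))) *ᵥ ψ)) *
          (star ψ ⬝ᵥ (((1 : Matrix a a ℂ) ⊗ₖ (Y ⊗ₖ (1 : Matrix e e ℂ))) *ᵥ ψ))) :
    (of fun (p q : a × b) => ∑ k, ψ (p.1, p.2, k) * star (ψ (q.1, q.2, k))) =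
      (of fun i i' => ∑ j, ∑ k, ψ (i, j, k) * star (ψ (i', j, k))) ⊗ₖ
        (of fun j j' => ∑ i, ∑ k, ψ (i, j, k) * star (ψ (i, j', k))) := by
  ext ⟨i, j⟩ ⟨i', j'⟩
  have := h (single i' i 1) (single j' j 1)
  simp only [mulVec, dotProduct, kronecker_apply, Fintype.sum_prod_type, one_apply, single_apply,
    Pi.star_apply] at this
  simp [ite_and, Finset.sum_ite_irrel] at this
  simp only [kronecker_apply, of_apply]
  simp only [mul_comm (ψ _)]
  simpa using this

end Relations

end Matrix

lemma four_smul_bellProj (i j : Fin 2) : (4 : ℂ) • bellProj i j =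
    (1 + (if i = j then (1 : ℂ) else -1) • pauliZ ⊗ₖ pauliZ) *
      (1 + (if i = 0 then (1 : ℂ) else -1) • pauliX ⊗ₖ pauliX) := by
  have hs : ((√2 : ℂ))⁻¹ * (√2 : ℂ)⁻¹ = 1 / 2 := by
    rw [← mul_inv, ← Complex.ofReal_mul, Real.mul_self_sqrt (by norm_num)]; norm_num
  ext ⟨p, q⟩ ⟨p', q'⟩
  fin_cases i <;> fin_cases j <;> fin_cases p <;> fin_cases q <;> fin_cases p' <;>
    fin_cases q' <;>
    simp [bellProj, bellVec, vecMulVec_apply, mul_apply, pauliZ, pauliX, Fintype.sum_prod_type,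
      Fin.sum_univ_two, one_apply, div_eq_mul_inv, hs] <;> norm_num

namespace Matrix

lemma conjTranspose_transpose_mul {l m n : Type*} [Fintype m] (X : Matrix l m ℂ)
    (Y : Matrix m n ℂ) : (X * Y)ᴴᵀ = Xᴴᵀ * Yᴴᵀ := by
  rw [conjTranspose_mul, transpose_mul]

lemma conjTranspose_transpose_kronecker_one {k g : Type*} [DecidableEq g] {P : Matrix k k ℂ}
    (hP : Pᴴᵀ = P) : (P ⊗ₖ (1 : Matrix g g ℂ))ᴴᵀ = P ⊗ₖ (1 : Matrix g g ℂ) := by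
  ext ⟨i, j⟩ ⟨i', j'⟩
  have := congrFun (congrFun hP i) i'
  simp only [transpose_apply, conjTranspose_apply] at this
  simp only [transpose_apply, conjTranspose_apply, kronecker_apply, star_mul', this, one_apply]
  split_ifs <;> simp

/-- If a purification of `1 ⊗ T Tᴴ` transfers real operators `P` to `Q`, then some unitary on
the purifying system brings the state to a maximally entangled form, and each `Q` to `P ⊗ 1`. -/
lemma exists_unitary_purifying_system {k g h e : Type*} [Fintype k] [Fintype g] [Fintype h]
    [Fintype e] [DecidableEq k] [DecidableEq g] [DecidableEq h] [DecidableEq e] [Nonempty k]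
    (hcard : Fintype.card e = Fintype.card k * Fintype.card h)
    {M : Matrix (k × g) e ℂ} {T : Matrix g g ℂ} (hT : T.det ≠ 0)
    (hM : M * Mᴴ = (1 : Matrix k k ℂ) ⊗ₖ (T * Tᴴ)) (hMM : (Mᴴ * M).det ≠ 0) :
    ∃ (U : Matrix (k × h) e ℂ) (σ : h ≃ g), U * Uᴴ = 1 ∧ Uᴴ * U = 1 ∧
      M * Uᵀ = ((1 : Matrix k k ℂ) ⊗ₖ T).submatrix id (Prod.map id σ) ∧
      ∀ (P : Matrix k k ℂ) (Q : Matrix e e ℂ), Pᴴᵀ = P → Q.IsHermitian →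
        (P ⊗ₖ (1 : Matrix g g ℂ)) * M = M * Qᵀ → U * Q * Uᴴ = P ⊗ₖ (1 : Matrix h h ℂ) := by
  obtain ⟨W, h1, h2, h3, h4⟩ := exists_unitary_purification hT hM hMM
  have hc : Fintype.card g = Fintype.card h := by
    have ht := trace_mul_comm W Wᴴ
    rw [h1, h2, trace_one, trace_one, hcard, Fintype.card_prod] at ht
    exact Nat.eq_of_mul_eq_mul_left Fintype.card_pos (by exact_mod_cast ht)
  let σ : h ≃ g := (Fintype.equivOfCardEq hc).symm
  let t : k × h ≃ k × g := Equiv.prodCongr (Equiv.refl k) σ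
  have w1 : Wᴴᵀ * Wᴴᵀᴴ = 1 := by
    have : Wᴴᵀᴴ = Wᵀ := by ext; simp
    rw [this, ← transpose_mul, h1, transpose_one]
  have w2 : Wᴴᵀᴴ * Wᴴᵀ = 1 := by
    have : Wᴴᵀᴴ = Wᵀ := by ext; simp
    rw [this, ← transpose_mul, h2, transpose_one]
  have hU : (Wᴴᵀ.submatrix t id)ᴴ = Wᴴᵀᴴ.submatrix id t := conjTranspose_submatrix _ _ _
  refine ⟨Wᴴᵀ.submatrix t id, σ, ?_, ?_, ?_, fun P Q hP hQ hPQ => ?_⟩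
  · rw [hU, ← submatrix_mul _ _ _ _ _ Function.bijective_id, w1, submatrix_one_equiv]
  · rw [hU, submatrix_mul_equiv, w2, submatrix_id_id]
  · rw [transpose_submatrix, transpose_transpose, ← Matrix.submatrix_id_id M,
      ← submatrix_mul _ _ _ _ _ Function.bijective_id, h3, Matrix.mul_assoc, h1, Matrix.mul_one]
    rfl
  · have h5 := congrArg (fun Y => Yᴴᵀ) (h4 P Qᵀ hPQ)
    simp only [conjTranspose_transpose_mul, conjTranspose_transpose_kronecker_one hP] at h5
    have hQ' : Qᵀᴴᵀ = Q := by
      have : Qᵀᴴᵀ = Qᴴ := by ext; simp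
      exact this.trans hQ.eq
    rw [hQ'] at h5
    rw [hU, ← Matrix.submatrix_id_id Q, ← submatrix_mul _ _ _ _ _ Function.bijective_id,
      ← submatrix_mul _ _ _ _ _ Function.bijective_id, ← h5, Matrix.mul_assoc, w1, Matrix.mul_one]
    ext ⟨i, j⟩ ⟨i', j'⟩
    simp [t, one_apply]

lemma kronecker_kronecker_submatrix_prodProdProdComm {a b c d : Type*}
    (A : Matrix a a ℂ) (B : Matrix b b ℂ) (C : Matrix c c ℂ) (D : Matrix d d ℂ) :
    ((A ⊗ₖ C) ⊗ₖ (B ⊗ₖ D)).submatrix (Equiv.prodProdProdComm a b c d)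
      (Equiv.prodProdProdComm a b c d) = (A ⊗ₖ B) ⊗ₖ (C ⊗ₖ D) := by
  ext ⟨⟨i, j⟩, k, l⟩ ⟨⟨i', j'⟩, k', l'⟩
  simp only [submatrix_apply, Equiv.prodProdProdComm_apply, kronecker_apply]
  ring

lemma tripartite_kronecker_mulVec {a b e a' b' e' : Type*} [Fintype a] [Fintype b] [Fintype e]
    (X : Matrix a' a ℂ) (Y : Matrix b' b ℂ) (W : Matrix e' e ℂ) (v : a × b × e → ℂ) :
    (of fun (p : a' × b') k => ((X ⊗ₖ (Y ⊗ₖ W)) *ᵥ v) (p.1, p.2, k)) =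
      (X ⊗ₖ Y) * (of fun (p : a × b) k => v (p.1, p.2, k)) * Wᵀ := by
  ext ⟨i, j⟩ k
  simp only [of_apply, mulVec, dotProduct, kronecker_apply, mul_apply, transpose_apply,
    Fintype.sum_prod_type, Finset.sum_mul]
  conv_rhs => rw [Finset.sum_comm]
  refine Finset.sum_congr rfl fun _ _ => ?_
  conv_rhs => rw [Finset.sum_comm]
  exact Finset.sum_congr rfl fun _ _ => Finset.sum_congr rfl fun _ _ => by ring

end Matrix

namespace Matrix

section Reduced

variable {a b e : Type*}

lemma reduced_first [Fintype b] [Fintype e] (ψ : a × b × e → ℂ) :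
    of (Function.curry ψ) * (of (Function.curry ψ))ᴴ =
      of fun i i' => ∑ j, ∑ k, ψ (i, j, k) * star (ψ (i', j, k)) := by
  ext i i'
  simp [mul_apply, Fintype.sum_prod_type, Function.curry]

lemma reduced_second [Fintype a] [Fintype e] (ψ : a × b × e → ℂ) :
    of (Function.curry fun p : b × a × e => ψ (p.2.1, p.1, p.2.2)) *
        (of (Function.curry fun p : b × a × e => ψ (p.2.1, p.1, p.2.2)))ᴴ =
      of fun j j' => ∑ i, ∑ k, ψ (i, j, k) * star (ψ (i, j', k)) := by
  ext i i'
  simp [mul_apply, Fintype.sum_prod_type, Function.curry]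

lemma reduced_third [Fintype a] [Fintype b] (ψ : a × b × e → ℂ) :
    of (Function.curry fun p : e × a × b => ψ (p.2.1, p.2.2, p.1)) *
        (of (Function.curry fun p : e × a × b => ψ (p.2.1, p.2.2, p.1)))ᴴ =
      of fun k k' => ∑ i, ∑ j, ψ (i, j, k) * star (ψ (i, j, k')) := by
  ext i i'
  simp [mul_apply, Fintype.sum_prod_type, Function.curry]

variable [Fintype a] [Fintype b] [Fintype e] [DecidableEq a] [DecidableEq b] [DecidableEq e]

lemma eq_zero_of_mulVec_first {ψ : a × b × e → ℂ}
    (h : (of fun i i' => ∑ j, ∑ k, ψ (i, j, k) * star (ψ (i', j, k))).det ≠ 0) (X : Matrix a a ℂ)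
    (hX : (X ⊗ₖ ((1 : Matrix b b ℂ) ⊗ₖ (1 : Matrix e e ℂ))) *ᵥ ψ = 0) : X = 0 := by
  rw [one_kronecker_one] at hX
  exact eq_zero_of_kronecker_one_mulVec (by rwa [reduced_first]) hX

lemma eq_zero_of_mulVec_second {ψ : a × b × e → ℂ}
    (h : (of fun j j' => ∑ i, ∑ k, ψ (i, j, k) * star (ψ (i, j', k))).det ≠ 0) (Y : Matrix b b ℂ)
    (hY : ((1 : Matrix a a ℂ) ⊗ₖ (Y ⊗ₖ (1 : Matrix e e ℂ))) *ᵥ ψ = 0) : Y = 0 := by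
  refine eq_zero_of_kronecker_one_mulVec (v := fun p : b × a × e => ψ (p.2.1, p.1, p.2.2))
    (by rwa [reduced_second]) ?_
  rw [← one_kronecker_one, kronecker_mulVec_swapLeft, hY]
  rfl

lemma eq_zero_of_mulVec_third {ψ : a × b × e → ℂ}
    (h : (of fun k k' => ∑ i, ∑ j, ψ (i, j, k) * star (ψ (i, j, k'))).det ≠ 0) (W : Matrix e e ℂ)
    (hW : ((1 : Matrix a a ℂ) ⊗ₖ ((1 : Matrix b b ℂ) ⊗ₖ W)) *ᵥ ψ = 0) : W = 0 := by
  refine eq_zero_of_kronecker_one_mulVec (v := fun p : e × a × b => ψ (p.2.1, p.2.2, p.1))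
    (by rwa [reduced_third]) ?_
  rw [← one_kronecker_one, kronecker_mulVec_rotate, hW]
  rfl

/-- A stabilizer relation `A ⊗ Z ⊗ E` on a state makes `A` and `Z` commute with the corresponding
reduced states. -/
lemma commute_reduced_of_stabilizer {ψ : a × b × e → ℂ} {A : Matrix a a ℂ} {Z : Matrix b b ℂ}
    {E : Matrix e e ℂ} (hA : A.IsHermitian) (hZ : Z.IsHermitian) (hE : E.IsHermitian)
    (hA2 : A * A = 1) (hE2 : E * E = 1)
    (h : (A ⊗ₖ ((1 : Matrix b b ℂ) ⊗ₖ E)) *ᵥ ψ =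
      ((1 : Matrix a a ℂ) ⊗ₖ (Z ⊗ₖ (1 : Matrix e e ℂ))) *ᵥ ψ) :
    (A * (of fun i i' => ∑ j, ∑ k, ψ (i, j, k) * star (ψ (i', j, k))) =
      (of fun i i' => ∑ j, ∑ k, ψ (i, j, k) * star (ψ (i', j, k))) * A) ∧
    (Z * (of fun j j' => ∑ i, ∑ k, ψ (i, j, k) * star (ψ (i, j', k))) =
      (of fun j j' => ∑ i, ∑ k, ψ (i, j, k) * star (ψ (i, j', k))) * Z) ∧
    (A ⊗ₖ Z) * (of fun (p : a × b) k => ψ (p.1, p.2, k)) =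
      (of fun (p : a × b) k => ψ (p.1, p.2, k)) * Eᵀ := by
  refine ⟨?_, ?_, ?_⟩
  · rw [← reduced_first]
    refine commute_reduced_of_kronecker_mulVec_eq hA (Y := Z ⊗ₖ E)
      ((conjTranspose_kronecker _ _).trans (by rw [hZ.eq, hE.eq])) ?_
    have := congrArg (fun v => ((1 : Matrix a a ℂ) ⊗ₖ ((1 : Matrix b b ℂ) ⊗ₖ E)) *ᵥ v) h
    simpa only [mulVec_kronecker_mul, hE2, Matrix.one_mul, Matrix.mul_one,
      one_kronecker_one] using this
  · rw [← reduced_second]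
    refine commute_reduced_of_kronecker_mulVec_eq hZ (Y := A ⊗ₖ E)
      ((conjTranspose_kronecker _ _).trans (by rw [hA.eq, hE.eq])) ?_
    rw [← one_kronecker_one, kronecker_mulVec_swapLeft, kronecker_mulVec_swapLeft, h]
  · have h1 := congrArg (fun v => (A ⊗ₖ ((1 : Matrix b b ℂ) ⊗ₖ (1 : Matrix e e ℂ))) *ᵥ v) h
    simp only [mulVec_kronecker_mul, hA2, Matrix.one_mul, Matrix.mul_one] at h1
    have h2 := congrArg (fun v : a × b × e → ℂ => of fun (p : a × b) k => v (p.1, p.2, k)) h1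
    simpa only [tripartite_kronecker_mulVec, transpose_one, Matrix.mul_one, one_kronecker_one,
      Matrix.one_mul] using h2.symm

end Reduced

end Matrix

namespace Matrix

lemma conj_mul_conj {m n : Type*} [Fintype m] [Fintype n] [DecidableEq n] {U : Matrix m n ℂ}
    (hU : Uᴴ * U = 1) (X Y : Matrix n n ℂ) : (U * X * Uᴴ) * (U * Y * Uᴴ) = U * (X * Y) * Uᴴ := by
  rw [show (U * X * Uᴴ) * (U * Y * Uᴴ) = U * X * (Uᴴ * U) * Y * Uᴴ by
    simp only [Matrix.mul_assoc], hU, Matrix.mul_one]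
  simp only [Matrix.mul_assoc]

lemma conj_eq_bellProj_kronecker_one {n h : Type*} [Fintype n] [Fintype h] [DecidableEq n]
    [DecidableEq h] {U : Matrix ((Fin 2 × Fin 2) × h) n ℂ} (hU : U * Uᴴ = 1) (hU' : Uᴴ * U = 1)
    {E F P : Matrix n n ℂ} (hE : U * E * Uᴴ = (pauliZ ⊗ₖ pauliZ) ⊗ₖ (1 : Matrix h h ℂ))
    (hF : U * F * Uᴴ = (pauliX ⊗ₖ pauliX) ⊗ₖ (1 : Matrix h h ℂ)) (i j : Fin 2)
    (hP : (4 : ℂ) • P = (1 + (if i = j then (1 : ℂ) else -1) • E) *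
      (1 + (if i = 0 then (1 : ℂ) else -1) • F)) :
    U * P * Uᴴ = bellProj i j ⊗ₖ (1 : Matrix h h ℂ) := by
  have key : ∀ (c : ℂ) (Q : Matrix n n ℂ) (R : Matrix (Fin 2 × Fin 2) (Fin 2 × Fin 2) ℂ),
      U * Q * Uᴴ = R ⊗ₖ (1 : Matrix h h ℂ) →
      U * (1 + c • Q) * Uᴴ = (1 + c • R) ⊗ₖ (1 : Matrix h h ℂ) := by
    intro c Q R hQ
    rw [Matrix.mul_add, Matrix.add_mul, Matrix.mul_one, hU, Matrix.mul_smul, Matrix.smul_mul, hQ,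
      add_kronecker, one_kronecker_one, smul_kronecker]
  refine smul_right_injective _ (four_ne_zero : (4 : ℂ) ≠ 0) ?_
  simp only
  rw [← smul_kronecker, four_smul_bellProj, ← Matrix.smul_mul, ← Matrix.mul_smul, hP,
    ← conj_mul_conj hU', key _ _ _ hE, key _ _ _ hF, ← mul_kronecker_mul, Matrix.one_mul]

lemma star_dotProduct_eq_trace {a b e : Type*} [Fintype a] [Fintype b] [Fintype e]
    (ψ : a × b × e → ℂ) : star ψ ⬝ᵥ ψ =
      ((of fun (p : a × b) k => ψ (p.1, p.2, k)) *
        (of fun (p : a × b) k => ψ (p.1, p.2, k))ᴴ).trace := by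
  simp [trace, mul_apply, dotProduct, Fintype.sum_prod_type, mul_comm]

lemma star_dotProduct_two_mul {a b c d : Type*} [Fintype a] [Fintype b] [Fintype c] [Fintype d]
    (T : Matrix (a × b) (a × b) ℂ) (σ : c × d ≃ a × b) :
    star (fun q : a × b × c × d => 2 * T (q.1, q.2.1) (σ (q.2.2.1, q.2.2.2))) ⬝ᵥ
      (fun q : a × b × c × d => 2 * T (q.1, q.2.1) (σ (q.2.2.1, q.2.2.2))) =
      4 * (T * Tᴴ).trace := by
  have h : ∀ f : a × b → ℂ, ∑ p, f p = ∑ x, ∑ y, f (σ (x, y)) := fun f => by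
    rw [← Fintype.sum_prod_type', ← Equiv.sum_comp σ]
  simp only [trace, diag_apply, mul_apply, conjTranspose_apply, h (fun q => T _ q * star (T _ q))]
  simp only [dotProduct, Fintype.sum_prod_type, Pi.star_apply, star_mul', Finset.mul_sum]
  refine Finset.sum_congr rfl fun _ _ => Finset.sum_congr rfl fun _ _ =>
    Finset.sum_congr rfl fun _ _ => Finset.sum_congr rfl fun _ _ => ?_
  rw [star_ofNat]
  ring

end Matrix

/-- Theorem 1 of the paper (self-testing in the weak-bilocality scenario):
if a pure state `|ψ⟩` with full-rank reduced states, dichotomic observables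
`A₀, A₁` (Alice) and `B₀, B₁` (Bob), and a four-outcome POVM `{N_{ij}}` (Eve)
produce operationally independent Alice–Bob correlations attaining the
quantum bound `2√2` of the weak-bilocality functional, then up to local
unitaries the state is `|φ⁺⟩_{A'Ā'} ⊗ |φ⁺⟩_{B'B̄'} ⊗ |ξ⟩`, Alice measures
`σ_z, σ_x`, Bob measures `(σ_z ± σ_x)/√2`, and Eve performs the Bell-basis
measurement. -/
theorem self_testing_weak_bilocality {a2 b2 e1 e2 : ℕ}
    (ha2 : 0 < a2) (hb2 : 0 < b2) (he1 : 0 < e1) (he2 : 0 < e2)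
    (ψ : Fin (2 * a2) × Fin (2 * b2) × Fin (4 * e1 * e2) → ℂ)
    (hψunit : star ψ ⬝ᵥ ψ = 1)
    (hfullA : (Matrix.of fun a a' : Fin (2 * a2) =>
        ∑ b, ∑ e, ψ (a, b, e) * star (ψ (a', b, e))).det ≠ 0)
    (hfullB : (Matrix.of fun b b' : Fin (2 * b2) =>
        ∑ a, ∑ e, ψ (a, b, e) * star (ψ (a, b', e))).det ≠ 0)
    (hfullE : (Matrix.of fun e e' : Fin (4 * e1 * e2) =>
        ∑ a, ∑ b, ψ (a, b, e) * star (ψ (a, b, e'))).det ≠ 0)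
    (A₀ A₁ : Matrix (Fin (2 * a2)) (Fin (2 * a2)) ℂ)
    (B₀ B₁ : Matrix (Fin (2 * b2)) (Fin (2 * b2)) ℂ)
    (hA₀ : A₀.IsHermitian) (hA₁ : A₁.IsHermitian)
    (hB₀ : B₀.IsHermitian) (hB₁ : B₁.IsHermitian)
    (hA₀sq : (1 - A₀ * A₀).PosSemidef) (hA₁sq : (1 - A₁ * A₁).PosSemidef)
    (hB₀sq : (1 - B₀ * B₀).PosSemidef) (hB₁sq : (1 - B₁ * B₁).PosSemidef)
    (N : Fin 2 → Fin 2 → Matrix (Fin (4 * e1 * e2)) (Fin (4 * e1 * e2)) ℂ)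
    (hN : ∀ i j, (N i j).PosSemidef) (hNsum : ∑ i, ∑ j, N i j = 1)
    -- (a) operational independence of Alice and Bob
    (hOI : ∀ (X : Matrix (Fin (2 * a2)) (Fin (2 * a2)) ℂ)
        (Y : Matrix (Fin (2 * b2)) (Fin (2 * b2)) ℂ),
      star ψ ⬝ᵥ ((X ⊗ₖ (Y ⊗ₖ
          (1 : Matrix (Fin (4 * e1 * e2)) (Fin (4 * e1 * e2)) ℂ))).mulVec ψ)
        = (star ψ ⬝ᵥ ((X ⊗ₖ ((1 : Matrix (Fin (2 * b2)) (Fin (2 * b2)) ℂ) ⊗ₖ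
            (1 : Matrix (Fin (4 * e1 * e2)) (Fin (4 * e1 * e2)) ℂ))).mulVec ψ))
          * (star ψ ⬝ᵥ (((1 : Matrix (Fin (2 * a2)) (Fin (2 * a2)) ℂ) ⊗ₖ (Y ⊗ₖ
              (1 : Matrix (Fin (4 * e1 * e2)) (Fin (4 * e1 * e2)) ℂ))).mulVec ψ)))
    -- (b) maximal violation of the weak-bilocality functional
    (hmax : star ψ ⬝ᵥ
        ((A₀ ⊗ₖ ((B₀ - B₁) ⊗ₖ (N 0 0 - N 0 1 - N 1 0 + N 1 1))
          + A₁ ⊗ₖ ((B₀ + B₁) ⊗ₖ (N 0 0 + N 0 1 - N 1 0 - N 1 1))).mulVec ψ)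
        = ((2 * Real.sqrt 2 : ℝ) : ℂ)) :
    ∃ (UA : Matrix (Fin 2 × Fin a2) (Fin (2 * a2)) ℂ)
      (UB : Matrix (Fin 2 × Fin b2) (Fin (2 * b2)) ℂ)
      (UE : Matrix ((Fin 2 × Fin 2) × Fin e1 × Fin e2) (Fin (4 * e1 * e2)) ℂ)
      (ξ : Fin a2 × Fin b2 × Fin e1 × Fin e2 → ℂ),
      UA * UAᴴ = 1 ∧ UAᴴ * UA = 1 ∧
      UB * UBᴴ = 1 ∧ UBᴴ * UB = 1 ∧
      UE * UEᴴ = 1 ∧ UEᴴ * UE = 1 ∧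
      star ξ ⬝ᵥ ξ = 1 ∧
      -- the state becomes |φ⁺⟩_{A'Ā'} ⊗ |φ⁺⟩_{B'B̄'} ⊗ |ξ⟩ (up to the
      -- canonical reordering of tensor factors, written componentwise)
      (∀ (x : Fin 2) (xa : Fin a2) (y : Fin 2) (yb : Fin b2)
          (z w : Fin 2) (ze : Fin e1) (we : Fin e2),
        ((UA ⊗ₖ (UB ⊗ₖ UE)).mulVec ψ) ((x, xa), (y, yb), ((z, w), ze, we))
          = ((if x = z then 1 else 0) / Real.sqrt 2)
            * ((if y = w then 1 else 0) / Real.sqrt 2)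
            * ξ (xa, yb, ze, we)) ∧
      UA * A₀ * UAᴴ = pauliZ ⊗ₖ (1 : Matrix (Fin a2) (Fin a2) ℂ) ∧
      UA * A₁ * UAᴴ = pauliX ⊗ₖ (1 : Matrix (Fin a2) (Fin a2) ℂ) ∧
      UB * B₀ * UBᴴ
        = ((Real.sqrt 2 : ℝ)⁻¹ • (pauliZ + pauliX)) ⊗ₖ
            (1 : Matrix (Fin b2) (Fin b2) ℂ) ∧
      UB * B₁ * UBᴴ
        = ((Real.sqrt 2 : ℝ)⁻¹ • (pauliX - pauliZ)) ⊗ₖ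
            (1 : Matrix (Fin b2) (Fin b2) ℂ) ∧
      (∀ i j, UE * N i j * UEᴴ
        = bellProj i j ⊗ₖ (1 : Matrix (Fin e1 × Fin e2) (Fin e1 × Fin e2) ℂ)) := by
  set E₀ := N 0 0 - N 0 1 - N 1 0 + N 1 1 with hE₀def
  set E₁ := N 0 0 + N 0 1 - N 1 0 - N 1 1 with hE₁def
  have hNh := fun i j => (hN i j).isHermitian
  have hE₀ : E₀.IsHermitian := (((hNh 0 0).sub (hNh 0 1)).sub (hNh 1 0)).add (hNh 1 1)
  have hE₁ : E₁.IsHermitian := (((hNh 0 0).add (hNh 0 1)).sub (hNh 1 0)).sub (hNh 1 1)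
  have hE₀c : (1 - E₀ * E₀).PosSemidef := by
    rw [show E₀ = (N 0 0 + N 1 1) - (N 0 1 + N 1 0) by rw [hE₀def]; abel]
    refine PosSemidef.one_sub_sq_of_add_eq_one ((hN 0 0).add (hN 1 1)) ((hN 0 1).add (hN 1 0)) ?_
    rw [← hNsum, Fin.sum_univ_two, Fin.sum_univ_two, Fin.sum_univ_two]; abel
  have hE₁c : (1 - E₁ * E₁).PosSemidef := by
    rw [show E₁ = (N 0 0 + N 0 1) - (N 1 0 + N 1 1) by rw [hE₁def]; abel]
    refine PosSemidef.one_sub_sq_of_add_eq_one ((hN 0 0).add (hN 0 1)) ((hN 1 0).add (hN 1 1)) ?_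
    rw [← hNsum, Fin.sum_univ_two, Fin.sum_univ_two, Fin.sum_univ_two]
  have fA := eq_zero_of_mulVec_first hfullA
  have fB := eq_zero_of_mulVec_second hfullB
  obtain ⟨hA₀2, hA₁2, hB₀2, hB₁2, hE₀2, hE₁2, hZ, hX⟩ :=
    weak_bilocality_stabilizer hψunit fA fB (eq_zero_of_mulVec_third hfullE) hA₀ hA₁ hB₀ hB₁
      hE₀ hE₁ hA₀sq hA₁sq hB₀sq hB₁sq hE₀c hE₁c hmax
  obtain ⟨hE, h00, h01, h10, h11⟩ := povm_eq_of_marginals_sq hN hNsum hE₀def hE₁def hE₀2 hE₁2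
  set Z := (√2)⁻¹ • (B₀ - B₁) with hZdef
  set X := (√2)⁻¹ • (B₀ + B₁) with hXdef
  have hZX : Z * X + X * Z = 0 := by
    rw [hZdef, hXdef]
    simp only [Matrix.smul_mul, Matrix.mul_smul, Matrix.sub_mul, Matrix.add_mul, Matrix.mul_sub,
      Matrix.mul_add, hB₀2, hB₁2, smul_add, smul_sub]
    abel
  have hZh : Z.IsHermitian := by
    rw [IsHermitian, hZdef, conjTranspose_smul, (hB₀.sub hB₁).eq, star_trivial]
  have hXh : X.IsHermitian := by
    rw [IsHermitian, hXdef, conjTranspose_smul, (hB₀.add hB₁).eq, star_trivial]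
  obtain ⟨hZ2, hX2, hA⟩ := anticommute_of_stabilizer fA fB hA₀2 hA₁2 hE₀2 hE₁2 hE hZX hZ hX
  obtain ⟨cA₀, cZ, hM₀⟩ := commute_reduced_of_stabilizer hA₀ hZh hE₀ hA₀2 hE₀2 hZ
  obtain ⟨cA₁, cX, hM₁⟩ := commute_reduced_of_stabilizer hA₁ hXh hE₁ hA₁2 hE₁2 hX
  obtain ⟨UA, TA, uA, uA', hUA₀, hUA₁, hTA, hUAρ⟩ := exists_unitary_pauli_of_commute hA₀ hA₁
    hA₀2 hA₁2 hA (by rw [← reduced_first]; exact posSemidef_self_mul_conjTranspose _) hfullA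
    cA₀ cA₁
  obtain ⟨UB, TB, uB, uB', hUZ, hUX, hTB, hUBρ⟩ := exists_unitary_pauli_of_commute hZh hXh
    hZ2 hX2 hZX (by rw [← reduced_second]; exact posSemidef_self_mul_conjTranspose _) hfullB
    cZ cX
  set L := of fun (p : Fin (2 * a2) × Fin (2 * b2)) k => ψ (p.1, p.2, k) with hL
  have hρ := reduced_eq_kronecker_of_independent hOI
  rw [show (of fun (p q : Fin (2 * a2) × Fin (2 * b2)) =>
      ∑ k, ψ (p.1, p.2, k) * star (ψ (q.1, q.2, k))) = L * Lᴴ by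
    ext; simp [hL, mul_apply]] at hρ
  have uAB : (UA ⊗ₖ UB)ᴴ * (UA ⊗ₖ UB) = 1 := by
    rw [conjTranspose_kronecker, ← mul_kronecker_mul, uA', uB', one_kronecker_one]
  let r := Equiv.prodProdProdComm (Fin 2) (Fin 2) (Fin a2) (Fin b2)
  set M := ((UA ⊗ₖ UB) * L).submatrix r id with hMdef
  have hMH : Mᴴ = (Lᴴ * (UA ⊗ₖ UB)ᴴ).submatrix id r := by
    rw [hMdef, conjTranspose_submatrix, conjTranspose_mul]
  have hMM : M * Mᴴ = 1 ⊗ₖ ((TA ⊗ₖ TB) * (TA ⊗ₖ TB)ᴴ) := by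
    rw [hMH, hMdef, ← submatrix_mul _ _ _ _ _ Function.bijective_id,
      show (UA ⊗ₖ UB) * L * (Lᴴ * (UA ⊗ₖ UB)ᴴ) = (UA ⊗ₖ UB) * (L * Lᴴ) * (UA ⊗ₖ UB)ᴴ by
        simp only [Matrix.mul_assoc], hρ, conjTranspose_kronecker, ← mul_kronecker_mul,
      ← mul_kronecker_mul, hUAρ, hUBρ, kronecker_kronecker_submatrix_prodProdProdComm,
      one_kronecker_one, conjTranspose_kronecker, ← mul_kronecker_mul]
  have hMM' : Mᴴ * M = Lᴴ * L := by
    rw [hMH, hMdef, submatrix_mul_equiv, submatrix_id_id, Matrix.mul_assoc, ← Matrix.mul_assoc _ _ L,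
      uAB, Matrix.one_mul]
  have hdetE : (Mᴴ * M).det ≠ 0 := by
    rw [hMM', ← det_transpose]
    convert hfullE using 2
    ext k k'
    simp [hL, mul_apply, Fintype.sum_prod_type, mul_comm]
  have hMrel : ∀ (P Q : Matrix (Fin 2) (Fin 2) ℂ) (A : Matrix (Fin (2 * a2)) (Fin (2 * a2)) ℂ)
      (B : Matrix (Fin (2 * b2)) (Fin (2 * b2)) ℂ)
      (E : Matrix (Fin (4 * e1 * e2)) (Fin (4 * e1 * e2)) ℂ),
      UA * A * UAᴴ = P ⊗ₖ (1 : Matrix (Fin a2) (Fin a2) ℂ) →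
      UB * B * UBᴴ = Q ⊗ₖ (1 : Matrix (Fin b2) (Fin b2) ℂ) → (A ⊗ₖ B) * L = L * Eᵀ →
      ((P ⊗ₖ Q) ⊗ₖ (1 : Matrix (Fin a2 × Fin b2) (Fin a2 × Fin b2) ℂ)) * M = M * Eᵀ := by
    intro P Q A B E hP hQ hL'
    rw [← one_kronecker_one, ← kronecker_kronecker_submatrix_prodProdProdComm, ← hP, ← hQ, hMdef,
      submatrix_mul_equiv, mul_kronecker_mul, mul_kronecker_mul, ← conjTranspose_kronecker,
      Matrix.mul_assoc, ← Matrix.mul_assoc _ _ L, uAB, Matrix.one_mul, Matrix.mul_assoc, hL',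
      ← Matrix.mul_assoc, ← Matrix.submatrix_id_id Eᵀ,
      ← submatrix_mul _ _ _ _ _ Function.bijective_id, Matrix.submatrix_id_id]
  have hT : (TA ⊗ₖ TB).det ≠ 0 := by
    rw [det_kronecker]
    exact mul_ne_zero (pow_ne_zero _ hTA) (pow_ne_zero _ hTB)
  obtain ⟨UE, σ, uE, uE', hUM, hUE⟩ := exists_unitary_purifying_system (k := Fin 2 × Fin 2)
    (h := Fin e1 × Fin e2) (by simp; ring) hT hMM hdetE
  have real_kron : ∀ P Q : Matrix (Fin 2) (Fin 2) ℂ, Pᴴᵀ = P → Qᴴᵀ = Q →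
      (P ⊗ₖ Q)ᴴᵀ = P ⊗ₖ Q := by
    intro P Q hP hQ
    rw [conjTranspose_kronecker, ← kroneckerMap_transpose, hP, hQ]
  have hZr : pauliZᴴᵀ = pauliZ := by
    rw [pauliZ_conjTranspose]; ext i j; fin_cases i <;> fin_cases j <;> simp [pauliZ]
  have hXr : pauliXᴴᵀ = pauliX := by
    rw [pauliX_conjTranspose]; ext i j; fin_cases i <;> fin_cases j <;> simp [pauliX]
  have hUE₀ := hUE _ _ (real_kron _ _ hZr hZr) hE₀ (hMrel _ _ _ _ _ hUA₀ hUZ hM₀)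
  have hUE₁ := hUE _ _ (real_kron _ _ hXr hXr) hE₁ (hMrel _ _ _ _ _ hUA₁ hUX hM₁)
  have hs : (√2)⁻¹ * (√2)⁻¹ = (1 / 2 : ℝ) := by
    rw [← mul_inv, Real.mul_self_sqrt (by norm_num)]; norm_num
  have hB₀' : B₀ = (√2)⁻¹ • (Z + X) := by
    rw [hZdef, hXdef, ← smul_add, smul_smul, hs, show B₀ - B₁ + (B₀ + B₁) = (2 : ℝ) • B₀ by
      rw [two_smul]; abel, smul_smul]
    norm_num
  have hB₁' : B₁ = (√2)⁻¹ • (X - Z) := by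
    rw [hZdef, hXdef, ← smul_sub, smul_smul, hs, show B₀ + B₁ - (B₀ - B₁) = (2 : ℝ) • B₁ by
      rw [two_smul]; abel, smul_smul]
    norm_num
  refine ⟨UA, UB, UE, fun q => 2 * (TA ⊗ₖ TB) (q.1, q.2.1) (σ (q.2.2.1, q.2.2.2)), uA, uA', uB,
    uB', uE, uE', ?_, ?_, hUA₀, hUA₁, ?_, ?_, fun i j => ?_⟩
  · rw [star_dotProduct_two_mul, ← hψunit, star_dotProduct_eq_trace, ← hL, trace_mul_comm L, ← hMM',
      trace_mul_comm Mᴴ, hMM, trace_kronecker, trace_one]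
    norm_num
  · intro x xa y yb z w ze we
    have h1 := congrFun (congrFun (tripartite_kronecker_mulVec UA UB UE ψ) ((x, xa), (y, yb)))
      ((z, w), ze, we)
    have h2 := congrFun (congrFun hUM ((x, y), (xa, yb))) ((z, w), (ze, we))
    have h3 : (M * UEᵀ) ((x, y), (xa, yb)) ((z, w), (ze, we)) =
        ((UA ⊗ₖ UB) * L * UEᵀ) ((x, xa), (y, yb)) ((z, w), (ze, we)) := rfl
    have hs' : ((√2 : ℂ))⁻¹ * (√2 : ℂ)⁻¹ = 1 / 2 := by
      rw [← Complex.ofReal_inv, ← Complex.ofReal_mul, hs]; norm_num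
    rw [of_apply] at h1
    rw [h1, ← hL, ← h3, h2, submatrix_apply, id, Prod.map_apply, id, kronecker_apply, one_apply,
      div_eq_mul_inv, div_eq_mul_inv, mul_mul_mul_comm (if x = z then (1 : ℂ) else 0) _ (if y = w then 1 else 0), hs']
    by_cases hx : x = z <;> by_cases hy : y = w <;> simp [hx, hy]
  · rw [hB₀', Matrix.mul_smul, Matrix.smul_mul, Matrix.mul_add, Matrix.add_mul, hUZ, hUX,
      smul_kronecker, add_kronecker]
  · rw [hB₁', Matrix.mul_smul, Matrix.smul_mul, Matrix.mul_sub, Matrix.sub_mul, hUZ, hUX,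
      smul_kronecker, sub_kronecker_s10]
  · refine conj_eq_bellProj_kronecker_one uE uE' hUE₀ hUE₁ i j ?_
    fin_cases i <;> fin_cases j
    · simpa using h00
    · simpa [sub_eq_add_neg] using h01
    · simpa [sub_eq_add_neg] using h10
    · simpa [sub_eq_add_neg] using h11
end
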